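/- arXiv:2003.01844 — 3 statements merged into one kernel-verified Lean document; each statement's English description precedes it below -/
import Mathlib

section
/- Proposition (ARI(Γ) is a Lie algebra): For a finite abelian group Γ, the pair (ARI(Γ), ari_u) is a Lie algebra over ℚ; in particular the bracket ari_u is ℚ-bilinear, satisfies ari_u(A,A) = 0, and satisfies the Jacobi identity ari_u(ari_u(A,B),C) + ari_u(ari_u(B,C),A) + ari_u(ari_u(C,A),B) = 0 for all A, B, C ∈ ARI(Γ). -/
namespace KVMould

/-- A mould over `Γ` in evaluation form: the depth-`m` component
`M m σ x` is the value of the rational function `M^m_{σ₁,…,σₘ}` at the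
rational point `x = (x₁,…,xₘ)` (indices are 0-based). -/
abbrev Mould (Γ : Type) : Type := (m : ℕ) → (Fin m → Γ) → (Fin m → ℚ) → ℚ

variable {Γ : Type} [CommGroup Γ]

/-- `M ∈ ARI(Γ)`: the depth `0` component vanishes. -/
def IsARI (M : Mould Γ) : Prop := ∀ σ x, M 0 σ x = 0

/-- Extension of a tuple of rationals by `0` outside the range. -/
def extQ {m : ℕ} (x : Fin m → ℚ) : ℕ → ℚ := fun i => if h : i < m then x ⟨i, h⟩ else 0

/-- Extension of a tuple of group elements by `1` outside the range. -/
def extG {m : ℕ} (σ : Fin m → Γ) : ℕ → Γ := fun i => if h : i < m then σ ⟨i, h⟩ else 1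

/-- The (noncommutative, nonunital on `ARI`) mould product `A × B`. -/
def mouldMul (A B : Mould Γ) : Mould Γ := fun m σ x =>
  ∑ k ∈ Finset.range (m + 1),
    A k (fun j => extG σ j.val) (fun j => extQ x j.val) *
      B (m - k) (fun j => extG σ (k + j.val)) (fun j => extQ x (k + j.val))

/-- Ecalle's derivation `arit_u(B)(A)` (0-indexed form of the paper's
Definition of `arit_u`; the blocks `k ≤ l` below are 0-based). -/
def aritU (B A : Mould Γ) : Mould Γ := fun m σ x =>
  (∑ k ∈ Finset.range m, ∑ l ∈ Finset.range m,
    if k ≤ l ∧ l + 1 < m then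
      A (m - (l - k + 1))
        (fun j => if j.val < k then extG σ j.val
          else if j.val = k then extG σ (l + 1)
          else extG σ (j.val + (l - k + 1)))
        (fun j => if j.val < k then extQ x j.val
          else if j.val = k then ∑ i ∈ Finset.Icc k (l + 1), extQ x i
          else extQ x (j.val + (l - k + 1))) *
      B (l - k + 1)
        (fun j => extG σ (k + j.val) * (extG σ (l + 1))⁻¹)
        (fun j => extQ x (k + j.val))
    else 0)
  -
  (∑ k ∈ Finset.range m, ∑ l ∈ Finset.range m,
    if 1 ≤ k ∧ k ≤ l then
      A (m - (l - k + 1))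
        (fun j => if j.val < k - 1 then extG σ j.val
          else if j.val = k - 1 then extG σ (k - 1)
          else extG σ (j.val + (l - k + 1)))
        (fun j => if j.val < k - 1 then extQ x j.val
          else if j.val = k - 1 then ∑ i ∈ Finset.Icc (k - 1) l, extQ x i
          else extQ x (j.val + (l - k + 1))) *
      B (l - k + 1)
        (fun j => extG σ (k + j.val) * (extG σ (k - 1))⁻¹)
        (fun j => extQ x (k + j.val))
    else 0)

/-- The `ari_u`-bracket: `ari_u(A,B) = arit_u(B)(A) − arit_u(A)(B) + A×B − B×A`. -/
def ariU (A B : Mould Γ) : Mould Γ :=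
  aritU B A - aritU A B + mouldMul A B - mouldMul B A

/-- `preari_u(A,B) = arit_u(B)(A) + A×B`. -/
def preariU (A B : Mould Γ) : Mould Γ := aritU B A + mouldMul A B

/-- The set of shuffle permutations `Sh(p,q)`. -/
def shuffles (p q : ℕ) : Finset (Equiv.Perm (Fin (p + q))) :=
  Finset.univ.filter fun τ =>
    (∀ i j : Fin (p + q), i.val < j.val → j.val < p → τ⁻¹ i < τ⁻¹ j) ∧
    (∀ i j : Fin (p + q), i.val < j.val → p ≤ i.val → τ⁻¹ i < τ⁻¹ j)

/-- Alternality of a mould. -/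
def IsAlternal (M : Mould Γ) : Prop :=
  ∀ p q : ℕ, 1 ≤ p → 1 ≤ q → ∀ (σ : Fin (p + q) → Γ) (x : Fin (p + q) → ℚ),
    ∑ τ ∈ shuffles p q, M (p + q) (fun i => σ (τ i)) (fun i => x (τ i)) = 0

/-- The `swap` of a mould. -/
def swapM (M : Mould Γ) : Mould Γ := fun m σ v =>
  M m (fun i => ∏ j ∈ Finset.range (m - i.val), extG σ j)
    (fun i => extQ v (m - 1 - i.val) - extQ v (m - i.val))

/-- Bialternality: `M` and `swap(M)` are alternal and the depth `1`
component is even (`M¹(x₁;σ₁) = M¹(−x₁;σ₁⁻¹)`). -/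
def IsBialternal (M : Mould Γ) : Prop :=
  IsAlternal M ∧ IsAlternal (swapM M) ∧
    ∀ (σ : Γ) (t : ℚ), M 1 (fun _ => σ) (fun _ => t) = M 1 (fun _ => σ⁻¹) (fun _ => -t)

/-- The `push` operator. -/
def pushM (M : Mould Γ) : Mould Γ := fun m σ x =>
  M m
    (fun i => if i.val = 0 then (extG σ (m - 1))⁻¹
      else extG σ (i.val - 1) * (extG σ (m - 1))⁻¹)
    (fun i => if i.val = 0 then -(∑ j ∈ Finset.range m, extQ x j)
      else extQ x (i.val - 1))

/-- The `v`-variant `arit_v(B)(A)`. -/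
def aritV (B A : Mould Γ) : Mould Γ := fun m σ v =>
  (∑ k ∈ Finset.range m, ∑ l ∈ Finset.range m,
    if k ≤ l ∧ l + 1 < m then
      A (m - (l - k + 1))
        (fun j => if j.val < k then extG σ j.val
          else if j.val = k then ∏ i ∈ Finset.Icc k (l + 1), extG σ i
          else extG σ (j.val + (l - k + 1)))
        (fun j => if j.val < k then extQ v j.val
          else if j.val = k then extQ v (l + 1)
          else extQ v (j.val + (l - k + 1))) *
      B (l - k + 1)
        (fun j => extG σ (k + j.val))
        (fun j => extQ v (k + j.val) - extQ v (l + 1))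
    else 0)
  -
  (∑ k ∈ Finset.range m, ∑ l ∈ Finset.range m,
    if 1 ≤ k ∧ k ≤ l then
      A (m - (l - k + 1))
        (fun j => if j.val < k - 1 then extG σ j.val
          else if j.val = k - 1 then ∏ i ∈ Finset.Icc (k - 1) l, extG σ i
          else extG σ (j.val + (l - k + 1)))
        (fun j => if j.val < k - 1 then extQ v j.val
          else if j.val = k - 1 then extQ v (k - 1)
          else extQ v (j.val + (l - k + 1))) *
      B (l - k + 1)
        (fun j => extG σ (k + j.val))
        (fun j => extQ v (k + j.val) - extQ v (k - 1))
    else 0)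

/-- The `ari_v`-bracket. -/
def ariV (A B : Mould Γ) : Mould Γ :=
  aritV B A - aritV A B + mouldMul A B - mouldMul B A

/-- Pus-neutrality: all cyclic shifts of every component sum to zero. -/
def IsPusNeutral (N : Mould Γ) : Prop :=
  ∀ m : ℕ, 1 ≤ m → ∀ (σ : Fin m → Γ) (v : Fin m → ℚ),
    ∑ i ∈ Finset.range m,
      N m (fun j => extG σ ((i + j.val) % m)) (fun j => extQ v ((i + j.val) % m)) = 0

/-- The subgroup `Γ^N = {g^N : g ∈ Γ}`. -/
def powSubgroup (Γ : Type) [CommGroup Γ] (N : ℕ) : Subgroup Γ :=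
  MonoidHom.range (powMonoidHom N)

/-- The map `i_N : ARI(Γ) → ARI(Γ^N)` (restriction of indices). -/
def iN (N : ℕ) (M : Mould Γ) : Mould (powSubgroup Γ N) := fun m σ x =>
  M m (fun i => (σ i : Γ)) x

/-- The map `m_N : ARI(Γ) → ARI(Γ^N)`. -/
def mN [Fintype Γ] [DecidableEq Γ] (N : ℕ) (M : Mould Γ) :
    Mould (powSubgroup Γ N) := fun m σ x =>
  ∑ τ ∈ Finset.univ.filter (fun τ : Fin m → Γ => ∀ i, τ i ^ N = (σ i : Γ)),
    M m τ (fun i => (N : ℚ) * x i)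

/-- `M` satisfies the distribution relations. -/
def IsARID [Fintype Γ] [DecidableEq Γ] (M : Mould Γ) : Prop :=
  ∀ N : ℕ, 1 ≤ N → N ∣ Fintype.card Γ → iN N M = mN N M

/-- The parallel translation map `t`. -/
def tMap (P : Mould Γ) : Mould Γ := fun m σ v =>
  if m ≤ 1 then P m σ v
  else P (m - 1) (fun j => extG σ (j.val + 1)) (fun j => extQ v (j.val + 1) - extQ v 0)

/-- `ũ := t ∘ swap`. -/
def uTilde (M : Mould Γ) : Mould Γ := tMap (swapM M)

section Cuts

variable {α β : Type*}

/-- The sum of `F a b` over all factorisations `w = a ++ b`. -/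
def cutSum : List α → (List α → List α → ℚ) → ℚ
  | [], F => F [] []
  | x :: w, F => F [] (x :: w) + cutSum w fun a b => F (x :: a) b

/-- The sum of `F p z q` over all factorisations `w = p ++ z :: q`. -/
def markSum : List α → (List α → α → List α → ℚ) → ℚ
  | [], _ => 0
  | x :: w, F => F [] x w + markSum w fun p z q => F (x :: p) z q

lemma cutSum_congr {w : List α} {F G : List α → List α → ℚ}
    (h : ∀ a b, a ++ b = w → F a b = G a b) : cutSum w F = cutSum w G := by
  induction w generalizing F G with
  | nil => exact h _ _ rfl
  | cons x w ih =>
    rw [cutSum, cutSum, h [] _ rfl, ih fun a b hab => h (x :: a) b (by simp [hab])]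

lemma markSum_congr {w : List α} {F G : List α → α → List α → ℚ}
    (h : ∀ p z q, p ++ z :: q = w → F p z q = G p z q) : markSum w F = markSum w G := by
  induction w generalizing F G with
  | nil => rfl
  | cons x w ih =>
    rw [markSum, markSum, h [] _ _ rfl, ih fun p z q hw => h (x :: p) z q (by simp [hw])]

lemma cutSum_add (w : List α) (F G : List α → List α → ℚ) :
    (cutSum w fun a b => F a b + G a b) = cutSum w F + cutSum w G := by
  induction w generalizing F G with
  | nil => rfl
  | cons x w ih => simp only [cutSum, ih]; ring

lemma cutSum_mul_left (w : List α) (c : ℚ) (F : List α → List α → ℚ) :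
    (cutSum w fun a b => c * F a b) = c * cutSum w F := by
  induction w generalizing F with
  | nil => rfl
  | cons x w ih => simp only [cutSum, ih]; ring

lemma cutSum_mul_right (w : List α) (c : ℚ) (F : List α → List α → ℚ) :
    (cutSum w fun a b => F a b * c) = cutSum w F * c := by
  simp only [mul_comm _ c, cutSum_mul_left]

lemma markSum_add (w : List α) (F G : List α → α → List α → ℚ) :
    (markSum w fun p z q => F p z q + G p z q) = markSum w F + markSum w G := by
  induction w generalizing F G with
  | nil => simp [markSum]
  | cons x w ih => simp only [markSum, ih]; ring

lemma markSum_mul_left (w : List α) (c : ℚ) (F : List α → α → List α → ℚ) :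
    (markSum w fun p z q => c * F p z q) = c * markSum w F := by
  induction w generalizing F with
  | nil => simp [markSum]
  | cons x w ih => simp only [markSum, ih]; ring

lemma markSum_mul_right (w : List α) (c : ℚ) (F : List α → α → List α → ℚ) :
    (markSum w fun p z q => F p z q * c) = markSum w F * c := by
  simp only [mul_comm _ c, markSum_mul_left]

lemma cutSum_zero (w : List α) : (cutSum w fun _ _ => 0) = 0 := by
  induction w with
  | nil => rfl
  | cons x w ih => simp [cutSum, ih]

lemma markSum_zero (w : List α) : (markSum w fun _ _ _ => 0) = 0 := by
  induction w with
  | nil => rfl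
  | cons x w ih => simp [markSum, ih]

lemma cutSum_map (f : α → β) (w : List α) (F : List β → List β → ℚ) :
    cutSum (w.map f) F = cutSum w fun a b => F (a.map f) (b.map f) := by
  induction w generalizing F with
  | nil => rfl
  | cons x w ih => simp [cutSum, ih]

lemma markSum_map (f : α → β) (w : List α) (F : List β → β → List β → ℚ) :
    markSum (w.map f) F = markSum w fun p z q => F (p.map f) (f z) (q.map f) := by
  induction w generalizing F with
  | nil => rfl
  | cons x w ih => simp [markSum, ih]

lemma cutSum_append_cons (a : List α) (z : α) (q : List α) (F : List α → List α → ℚ) :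
    cutSum (a ++ z :: q) F =
      (cutSum a fun a₁ a₂ => F a₁ (a₂ ++ z :: q)) + cutSum q fun q₁ q₂ => F (a ++ z :: q₁) q₂ := by
  induction a generalizing F with
  | nil => rfl
  | cons x w ih => simp [cutSum, ih, add_assoc]

lemma cutSum_concat (w : List α) (z : α) (F : List α → List α → ℚ) :
    cutSum (w ++ [z]) F = (cutSum w fun a b => F a (b ++ [z])) + F (w ++ [z]) [] :=
  cutSum_append_cons w z [] F

lemma markSum_concat (w : List α) (s : α) (F : List α → α → List α → ℚ) :
    markSum (w ++ [s]) F = (markSum w fun p z q => F p z (q ++ [s])) + F w s [] := by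
  induction w generalizing F with
  | nil => simp [markSum]
  | cons x w ih => simp [markSum, ih, add_assoc]

lemma cutSum_cutSum (w : List α) (F : List α → List α → List α → ℚ) :
    (cutSum w fun r c => cutSum r fun a b => F a b c) =
      cutSum w fun a r => cutSum r fun b c => F a b c := by
  induction w generalizing F with
  | nil => rfl
  | cons x w ih => simp only [cutSum, cutSum_add, ih]; ring

lemma cutSum_comm (v : List α) (w : List β) (F : List α → List α → List β → List β → ℚ) :
    (cutSum v fun a b => cutSum w fun c d => F a b c d) =
      cutSum w fun c d => cutSum v fun a b => F a b c d := by
  induction v generalizing F with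
  | nil => rfl
  | cons x v ih => simp only [cutSum, cutSum_add, ih]

lemma cutSum_markSum_left (w : List α) (F : List α → α → List α → List α → ℚ) :
    (cutSum w fun u v => markSum u fun p z q => F p z q v) =
      markSum w fun p z r => cutSum r fun q v => F p z q v := by
  induction w generalizing F with
  | nil => rfl
  | cons x w ih => simp only [cutSum, markSum, cutSum_add, ih]; ring

lemma cutSum_markSum_right (w : List α) (F : List α → List α → α → List α → ℚ) :
    (cutSum w fun u v => markSum v fun p z q => F u p z q) =
      markSum w fun r z q => cutSum r fun u p => F u p z q := by
  induction w generalizing F with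
  | nil => rfl
  | cons x w ih => simp only [cutSum, markSum, markSum_add, ih]; ring

lemma cutSum_eq_sum_range (w : List α) (F : List α → List α → ℚ) :
    cutSum w F = ∑ k ∈ Finset.range (w.length + 1), F (w.take k) (w.drop k) := by
  induction w generalizing F with
  | nil => simp [cutSum]
  | cons x w ih =>
    rw [cutSum, ih, List.length_cons, Finset.sum_range_succ' _ (w.length + 1), add_comm]
    rfl

lemma markSum_eq_sum_range (w : List α) (d : α) (F : List α → α → List α → ℚ) :
    markSum w F =
      ∑ k ∈ Finset.range w.length, F (w.take k) (w.getD k d) (w.drop (k + 1)) := by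
  induction w generalizing F with
  | nil => simp [markSum]
  | cons x w ih =>
    rw [markSum, ih, List.length_cons, Finset.sum_range_succ', add_comm]
    rfl

/-- The product of moulds, on functions of lists. -/
def conv : (List α → ℚ) →ₗ[ℚ] (List α → ℚ) →ₗ[ℚ] (List α → ℚ) :=
  LinearMap.mk₂ ℚ (fun A B w => cutSum w fun a b => A a * B b)
    (fun A A' B => by ext w; simp [add_mul, cutSum_add])
    (fun c A B => by ext w; simp [mul_assoc, cutSum_mul_left])
    (fun A B B' => by ext w; simp [mul_add, cutSum_add])
    (fun c A B => by ext w; simp [mul_left_comm, cutSum_mul_left])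

lemma conv_apply (A B : List α → ℚ) (w : List α) :
    conv A B w = cutSum w fun a b => A a * B b := rfl

lemma conv_assoc (A B C : List α → ℚ) : conv (conv A B) C = conv A (conv B C) := by
  ext w
  simp only [conv_apply, ← cutSum_mul_right, ← cutSum_mul_left, mul_assoc]
  exact cutSum_cutSum w fun a b c => A a * (B b * C c)

/-- Restriction of a function of letters to one-letter words, extended by zero. -/
def letterFun (f : α → ℚ) : List α → ℚ
  | [z] => f z
  | _ => 0

lemma letterFun_append_cons (f : α → ℚ) (a : List α) (z : α) (q : List α) :
    letterFun f (a ++ z :: q) = if a = [] ∧ q = [] then f z else 0 := by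
  rcases a with _ | ⟨x, _ | ⟨y, a⟩⟩ <;> rcases q with _ | ⟨y', q⟩ <;> simp [letterFun]

/-- Each value of `E A` depends on finitely many values of `A` only. -/
def IsLocal (E : (List α → ℚ) →ₗ[ℚ] (List α → ℚ)) : Prop :=
  ∀ w, ∃ S : Finset (List α), ∀ A, (∀ u ∈ S, A u = 0) → E A w = 0

lemma IsLocal.sub {E E' : (List α → ℚ) →ₗ[ℚ] (List α → ℚ)} (h : IsLocal E) (h' : IsLocal E') :
    IsLocal (E - E') := by
  classical
  intro w
  obtain ⟨S, hS⟩ := h w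
  obtain ⟨S', hS'⟩ := h' w
  refine ⟨S ∪ S', fun A hA => ?_⟩
  simp [hS A fun u hu => hA u (Finset.mem_union_left _ hu),
    hS' A fun u hu => hA u (Finset.mem_union_right _ hu)]

lemma IsLocal.comp {E E' : (List α → ℚ) →ₗ[ℚ] (List α → ℚ)} (h : IsLocal E) (h' : IsLocal E') :
    IsLocal (E ∘ₗ E') := by
  classical
  intro w
  obtain ⟨S, hS⟩ := h w
  choose T hT using h'
  exact ⟨S.biUnion T, fun A hA => hS _ fun u hu => hT u A fun v hv =>
    hA v (Finset.mem_biUnion.2 ⟨u, hu, hv⟩)⟩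

lemma exists_finset_cutSum_eq_zero (w : List α) (g : List α → List α → List α)
    (r : List α → List α → ℚ) :
    ∃ S : Finset (List α), ∀ A : List α → ℚ, (∀ u ∈ S, A u = 0) →
      (cutSum w fun a b => A (g a b) * r a b) = 0 := by
  classical
  induction w generalizing g r with
  | nil => exact ⟨{g [] []}, fun A hA => by simp [cutSum, hA]⟩
  | cons x w ih =>
    obtain ⟨S, hS⟩ := ih (fun a => g (x :: a)) fun a => r (x :: a)
    refine ⟨insert (g [] (x :: w)) S, fun A hA => ?_⟩
    rw [cutSum, hA _ (Finset.mem_insert_self _ _), zero_mul, zero_add]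
    exact hS A fun u hu => hA u (Finset.mem_insert_of_mem hu)

lemma exists_finset_markSum_eq_zero (w : List α)
    (F : (List α → ℚ) → List α → α → List α → ℚ)
    (hF : ∀ p z q, ∃ S : Finset (List α), ∀ A, (∀ u ∈ S, A u = 0) → F A p z q = 0) :
    ∃ S : Finset (List α), ∀ A, (∀ u ∈ S, A u = 0) → markSum w (F A) = 0 := by
  classical
  induction w generalizing F with
  | nil => exact ⟨∅, fun A _ => rfl⟩
  | cons x w ih =>
    obtain ⟨S, hS⟩ := ih (fun A p => F A (x :: p)) fun p => hF (x :: p)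
    obtain ⟨T, hT⟩ := hF [] x w
    refine ⟨T ∪ S, fun A hA => ?_⟩
    rw [markSum, hT A fun u hu => hA u (Finset.mem_union_left _ hu), zero_add]
    exact hS A fun u hu => hA u (Finset.mem_union_right _ hu)

lemma conv_single_nil [DecidableEq α] (A : List α → ℚ) : conv (Pi.single [] 1) A = A := by
  ext w
  rw [conv_apply]
  cases w <;> simp [cutSum, cutSum_zero]

lemma conv_nil_single [DecidableEq α] (A : List α → ℚ) : conv A (Pi.single [] 1) = A := by
  ext w
  rw [conv_apply]
  rcases List.eq_nil_or_concat' w with rfl | ⟨u, s, rfl⟩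
  · simp [cutSum]
  · simp [cutSum_concat, cutSum_zero]

lemma conv_letterFun_single [DecidableEq α] (x : α) (u : List α) :
    conv (letterFun (Pi.single x 1)) (Pi.single u 1) = Pi.single (x :: u) 1 := by
  ext w
  rw [conv_apply]
  rcases w with _ | ⟨y, _ | ⟨z, w⟩⟩ <;>
    simp [cutSum, cutSum_zero, letterFun, Pi.single_apply, ← ite_and, and_comm]

/-- A local derivation of `conv` which kills all functions supported on one-letter words
is zero. -/
lemma IsLocal.eq_zero {E : (List α → ℚ) →ₗ[ℚ] (List α → ℚ)} (hE : IsLocal E)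
    (hmul : ∀ A C, E (conv A C) = conv (E A) C + conv A (E C))
    (hletter : ∀ f, E (letterFun f) = 0) : E = 0 := by
  classical
  have hone : E (Pi.single [] 1) = 0 := by
    have h := hmul (Pi.single [] 1) (Pi.single [] 1)
    simpa [conv_single_nil, conv_nil_single] using h
  have hsingle : ∀ u, E (Pi.single u 1) = 0 := by
    intro u
    induction u with
    | nil => exact hone
    | cons x u ih => rw [← conv_letterFun_single, hmul, hletter, ih]; simp
  ext A w
  obtain ⟨S, hS⟩ := hE w
  have h := hS (A - ∑ u ∈ S, A u • Pi.single u 1) fun v hv => by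
    simp [Finset.sum_apply, Pi.single_apply, hv]
  simpa [map_sum, hsingle] using h

end Cuts

section WordFunctions

variable {G : Type*}

/-- Words in the alphabet `G × ℚ`. -/
abbrev Word (G : Type*) : Type _ := List (G × ℚ)

/-- The sum of the rational components of the letters of a word. -/
def weight (w : Word G) : ℚ := (w.map Prod.snd).sum

@[simp] lemma weight_nil : weight ([] : Word G) = 0 := rfl

@[simp] lemma weight_cons (z : G × ℚ) (w : Word G) : weight (z :: w) = z.2 + weight w := by
  simp [weight]

@[simp] lemma weight_append (v w : Word G) : weight (v ++ w) = weight v + weight w := by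
  simp [weight]

variable [Group G]

/-- Division of all group components of a word by `g`. -/
def twist (g : G) (w : Word G) : Word G := w.map fun z => (z.1 * g⁻¹, z.2)

@[simp] lemma weight_twist (g : G) (w : Word G) : weight (twist g w) = weight w := by
  simp [weight, twist, Function.comp_def]

@[simp] lemma twist_nil (g : G) : twist g [] = [] := rfl

@[simp] lemma twist_cons (g : G) (z : G × ℚ) (w : Word G) :
    twist g (z :: w) = (z.1 * g⁻¹, z.2) :: twist g w := rfl

@[simp] lemma twist_append (g : G) (v w : Word G) :
    twist g (v ++ w) = twist g v ++ twist g w := by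
  simp [twist]

@[simp] lemma twist_twist (g h : G) (w : Word G) :
    twist (h * g⁻¹) (twist g w) = twist h w := by
  simp [twist, Function.comp_def]

lemma cutSum_twist (g : G) (w : Word G) (F : Word G → Word G → ℚ) :
    cutSum (twist g w) F = cutSum w fun a b => F (twist g a) (twist g b) :=
  cutSum_map _ _ _

lemma markSum_twist (g : G) (w : Word G) (F : Word G → G × ℚ → Word G → ℚ) :
    markSum (twist g w) F =
      markSum w fun p z q => F (twist g p) (z.1 * g⁻¹, z.2) (twist g q) :=
  markSum_map _ _ _

/-- The part of `arit` in which a letter absorbs a block to its left. -/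
def aritL : (Word G → ℚ) →ₗ[ℚ] (Word G → ℚ) →ₗ[ℚ] (Word G → ℚ) :=
  LinearMap.mk₂ ℚ (fun B A w => markSum w fun p z q => cutSum p fun a b =>
      A (a ++ (z.1, weight b + z.2) :: q) * B (twist z.1 b))
    (fun A A' B => by ext w; simp [mul_add, cutSum_add, markSum_add])
    (fun c A B => by ext w; simp [mul_left_comm, cutSum_mul_left, markSum_mul_left])
    (fun A B B' => by ext w; simp [add_mul, cutSum_add, markSum_add])
    (fun c A B => by ext w; simp [mul_assoc, cutSum_mul_left, markSum_mul_left])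

/-- The part of `arit` in which a letter absorbs a block to its right. -/
def aritR : (Word G → ℚ) →ₗ[ℚ] (Word G → ℚ) →ₗ[ℚ] (Word G → ℚ) :=
  LinearMap.mk₂ ℚ (fun B A w => markSum w fun p z q => cutSum q fun b c =>
      A (p ++ (z.1, z.2 + weight b) :: c) * B (twist z.1 b))
    (fun A A' B => by ext w; simp [mul_add, cutSum_add, markSum_add])
    (fun c A B => by ext w; simp [mul_left_comm, cutSum_mul_left, markSum_mul_left])
    (fun A B B' => by ext w; simp [add_mul, cutSum_add, markSum_add])
    (fun c A B => by ext w; simp [mul_assoc, cutSum_mul_left, markSum_mul_left])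

lemma aritL_apply (B A : Word G → ℚ) (w : Word G) :
    aritL B A w = markSum w fun p z q => cutSum p fun a b =>
      A (a ++ (z.1, weight b + z.2) :: q) * B (twist z.1 b) := rfl

lemma aritR_apply (B A : Word G → ℚ) (w : Word G) :
    aritR B A w = markSum w fun p z q => cutSum q fun b c =>
      A (p ++ (z.1, z.2 + weight b) :: c) * B (twist z.1 b) := rfl

lemma aritL_conv (B A C : Word G → ℚ) :
    aritL B (conv A C) = conv (aritL B A) C + conv A (aritL B C) := by
  ext w
  simp only [Pi.add_apply, conv_apply, aritL_apply, cutSum_append_cons, add_mul, cutSum_add,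
    markSum_add, ← cutSum_mul_right, ← cutSum_mul_left, ← markSum_mul_right, ← markSum_mul_left]
  rw [cutSum_markSum_left, cutSum_markSum_right, add_comm]
  congr 1
  · refine markSum_congr fun p z q _ => ?_
    rw [cutSum_comm]
    simp only [mul_right_comm]
  · refine markSum_congr fun p z q _ => ?_
    rw [cutSum_cutSum p fun a₁ a₂ b =>
      A a₁ * C (a₂ ++ (z.1, weight b + z.2) :: q) * B (twist z.1 b)]
    simp only [mul_assoc]

lemma aritR_conv (B A C : Word G → ℚ) :
    aritR B (conv A C) = conv (aritR B A) C + conv A (aritR B C) := by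
  ext w
  simp only [Pi.add_apply, conv_apply, aritR_apply, cutSum_append_cons, add_mul, cutSum_add,
    markSum_add, ← cutSum_mul_right, ← cutSum_mul_left, ← markSum_mul_right, ← markSum_mul_left]
  rw [cutSum_markSum_left, cutSum_markSum_right, add_comm]
  congr 1
  · refine markSum_congr fun p z q _ => ?_
    rw [cutSum_cutSum q fun b c d => A (p ++ (z.1, z.2 + weight b) :: c) * B (twist z.1 b) * C d]
    simp only [mul_right_comm]
  · refine markSum_congr fun p z q _ => ?_
    rw [cutSum_comm]
    simp only [mul_assoc]

/-- The part of `arit B (letterFun f)` in which the last letter absorbs all others. -/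
def lastAbsorb (f : G × ℚ → ℚ) : (Word G → ℚ) →ₗ[ℚ] (Word G → ℚ) where
  toFun B w := (w.getLast?).elim 0 fun z => f (z.1, weight w) * B (twist z.1 w.dropLast)
  map_add' A B := by ext w; cases h : w.getLast? <;> simp [h, mul_add]
  map_smul' c A := by ext w; cases h : w.getLast? <;> simp [h, mul_left_comm]

/-- The part of `arit B (letterFun f)` in which the first letter absorbs all others. -/
def headAbsorb (f : G × ℚ → ℚ) : (Word G → ℚ) →ₗ[ℚ] (Word G → ℚ) where
  toFun B w := (w.head?).elim 0 fun z => f (z.1, weight w) * B (twist z.1 w.tail)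
  map_add' A B := by ext w; cases h : w.head? <;> simp [h, mul_add]
  map_smul' c A := by ext w; cases h : w.head? <;> simp [h, mul_left_comm]

/-- The sum over letters absorbing everything on both sides. -/
def midAbsorb (f : G × ℚ → ℚ) (B C : Word G → ℚ) : Word G → ℚ := fun w =>
  markSum w fun p z q => f (z.1, weight w) * B (twist z.1 p) * C (twist z.1 q)

@[simp] lemma lastAbsorb_nil (f : G × ℚ → ℚ) (B : Word G → ℚ) : lastAbsorb f B [] = 0 := rfl

@[simp] lemma headAbsorb_nil (f : G × ℚ → ℚ) (B : Word G → ℚ) : headAbsorb f B [] = 0 := rfl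

lemma lastAbsorb_concat (f : G × ℚ → ℚ) (B : Word G → ℚ) (u : Word G) (s : G × ℚ) :
    lastAbsorb f B (u ++ [s]) = f (s.1, weight (u ++ [s])) * B (twist s.1 u) := by
  simp [lastAbsorb]

lemma headAbsorb_cons (f : G × ℚ → ℚ) (B : Word G → ℚ) (v : Word G) (t : G × ℚ) :
    headAbsorb f B (t :: v) = f (t.1, weight (t :: v)) * B (twist t.1 v) := rfl

lemma aritL_letterFun (f : G × ℚ → ℚ) (B : Word G → ℚ) :
    aritL B (letterFun f) = lastAbsorb f B := by
  ext w
  rw [aritL_apply]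
  rcases List.eq_nil_or_concat' w with rfl | ⟨u, s, rfl⟩
  · rfl
  · simp only [markSum_concat, lastAbsorb_concat, letterFun_append_cons]
    cases u <;> simp [cutSum, cutSum_zero, markSum_zero, add_assoc]

lemma aritR_letterFun (f : G × ℚ → ℚ) (B : Word G → ℚ) :
    aritR B (letterFun f) = headAbsorb f B := by
  ext w
  rw [aritR_apply]
  rcases w with _ | ⟨t, v⟩
  · rfl
  · simp only [markSum, headAbsorb_cons, letterFun_append_cons]
    rcases List.eq_nil_or_concat' v with rfl | ⟨u, s, rfl⟩ <;>
      simp [cutSum, cutSum_concat, cutSum_zero, markSum_zero]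

lemma aritL_lastAbsorb (f : G × ℚ → ℚ) (B C : Word G → ℚ) :
    aritL C (lastAbsorb f B) = lastAbsorb f (aritL C B + conv B C) := by
  ext w
  rw [aritL_apply]
  rcases List.eq_nil_or_concat' w with rfl | ⟨u, s, rfl⟩
  · rfl
  rw [markSum_concat, lastAbsorb_concat, Pi.add_apply, aritL_apply, conv_apply, markSum_twist,
    cutSum_twist, mul_add, ← markSum_mul_left, ← cutSum_mul_left]
  congr 1
  · refine markSum_congr fun p z q hw => ?_
    rw [cutSum_twist, ← cutSum_mul_left]
    refine cutSum_congr fun a b hp => ?_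
    subst hp hw
    rw [← List.cons_append, ← List.append_assoc, lastAbsorb_concat]
    simp [mul_assoc, add_assoc]
  · refine cutSum_congr fun a b hp => ?_
    subst hp
    rw [lastAbsorb_concat]
    simp [mul_assoc]

lemma aritR_lastAbsorb (f : G × ℚ → ℚ) (B C : Word G → ℚ) :
    aritR C (lastAbsorb f B) = lastAbsorb f (aritR C B) + midAbsorb f B C := by
  ext w
  rw [Pi.add_apply, aritR_apply]
  rcases List.eq_nil_or_concat' w with rfl | ⟨u, s, rfl⟩
  · simp [markSum, midAbsorb]
  rw [midAbsorb, markSum_concat, markSum_concat, lastAbsorb_concat, aritR_apply, markSum_twist,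
    ← markSum_mul_left, ← add_assoc, ← markSum_add]
  congr 1
  · refine markSum_congr fun p z q hw => ?_
    subst hw
    rw [cutSum_twist, ← cutSum_mul_left, cutSum_concat]
    congr 1
    · refine cutSum_congr fun b c hq => ?_
      subst hq
      rw [← List.cons_append, ← List.append_assoc, lastAbsorb_concat]
      simp [mul_assoc, add_assoc]
    · rw [lastAbsorb_concat]
      simp
  · simp [cutSum, lastAbsorb_concat]

lemma aritL_headAbsorb (f : G × ℚ → ℚ) (B C : Word G → ℚ) :
    aritL C (headAbsorb f B) = headAbsorb f (aritL C B) + midAbsorb f C B := by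
  ext w
  rw [Pi.add_apply, aritL_apply]
  rcases w with _ | ⟨t, v⟩
  · simp [markSum, midAbsorb]
  rw [midAbsorb, markSum, markSum, headAbsorb_cons, aritL_apply, markSum_twist,
    ← markSum_mul_left, add_left_comm, ← markSum_add]
  congr 1
  · simp [cutSum, headAbsorb_cons, mul_right_comm]
  · refine markSum_congr fun p z q hw => ?_
    subst hw
    rw [cutSum_twist, ← cutSum_mul_left, cutSum, add_comm]
    congr 1
    · refine cutSum_congr fun a b hp => ?_
      subst hp
      rw [List.cons_append, headAbsorb_cons]
      simp [mul_assoc, add_assoc]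
    · rw [List.nil_append, headAbsorb_cons]
      simp [add_assoc, mul_right_comm]

lemma aritR_headAbsorb (f : G × ℚ → ℚ) (B C : Word G → ℚ) :
    aritR C (headAbsorb f B) = headAbsorb f (aritR C B + conv C B) := by
  ext w
  rw [aritR_apply]
  rcases w with _ | ⟨t, v⟩
  · rfl
  rw [markSum, headAbsorb_cons, Pi.add_apply, aritR_apply, conv_apply, markSum_twist,
    cutSum_twist, mul_add, ← markSum_mul_left, ← cutSum_mul_left, add_comm]
  congr 1
  · refine markSum_congr fun p z q hw => ?_
    rw [cutSum_twist, ← cutSum_mul_left]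
    refine cutSum_congr fun b c hq => ?_
    subst hq hw
    rw [List.cons_append, headAbsorb_cons]
    simp [mul_assoc, add_assoc]
  · refine cutSum_congr fun b c hq => ?_
    subst hq
    rw [List.nil_append, headAbsorb_cons]
    simp only [weight_append, weight_cons, add_assoc]
    ring

/-- Ecalle's `arit` on functions of words. -/
def aritW : (Word G → ℚ) →ₗ[ℚ] (Word G → ℚ) →ₗ[ℚ] (Word G → ℚ) := aritL - aritR

/-- The `ari`-bracket on functions of words. -/
def ariW (A B : Word G → ℚ) : Word G → ℚ :=
  aritW B A - aritW A B + conv A B - conv B A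

lemma ariW_smul_add_left (c : ℚ) (A A' B : Word G → ℚ) :
    ariW (c • A + A') B = c • ariW A B + ariW A' B := by
  simp only [ariW, map_add, map_smul, LinearMap.add_apply, LinearMap.smul_apply]
  module

lemma ariW_smul_add_right (c : ℚ) (A A' B : Word G → ℚ) :
    ariW B (c • A + A') = c • ariW B A + ariW B A' := by
  simp only [ariW, map_add, map_smul, LinearMap.add_apply, LinearMap.smul_apply]
  module

lemma aritW_conv (B A C : Word G → ℚ) :
    aritW B (conv A C) = conv (aritW B A) C + conv A (aritW B C) := by
  simp only [aritW, LinearMap.sub_apply, aritL_conv, aritR_conv, map_sub]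
  abel

lemma aritW_commutator_letterFun (f : G × ℚ → ℚ) (B C : Word G → ℚ) :
    aritW C (aritW B (letterFun f)) - aritW B (aritW C (letterFun f)) =
      aritW (ariW B C) (letterFun f) := by
  simp only [ariW, aritW, LinearMap.sub_apply, LinearMap.add_apply, aritL_letterFun,
    aritR_letterFun, map_sub, map_add, aritL_lastAbsorb, aritR_lastAbsorb,
    aritL_headAbsorb, aritR_headAbsorb]
  abel

lemma isLocal_aritW (B : Word G → ℚ) : IsLocal (aritW B) := by
  refine IsLocal.sub (E := aritL B) (E' := aritR B) (fun w => ?_) (fun w => ?_)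
  · exact exists_finset_markSum_eq_zero w _ fun p z q => exists_finset_cutSum_eq_zero p
      (fun a b => a ++ (z.1, weight b + z.2) :: q) fun _ b => B (twist z.1 b)
  · exact exists_finset_markSum_eq_zero w _ fun p z q => exists_finset_cutSum_eq_zero q
      (fun b c => p ++ (z.1, z.2 + weight b) :: c) fun b _ => B (twist z.1 b)

lemma aritW_commutator (A B C : Word G → ℚ) :
    aritW C (aritW B A) - aritW B (aritW C A) = aritW (ariW B C) A := by
  have h : aritW C ∘ₗ aritW B - aritW B ∘ₗ aritW C - aritW (ariW B C) = 0 := by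
    refine IsLocal.eq_zero ?_ (fun A C => ?_) fun f => ?_
    · exact (((isLocal_aritW C).comp (isLocal_aritW B)).sub
        ((isLocal_aritW B).comp (isLocal_aritW C))).sub (isLocal_aritW _)
    · simp only [LinearMap.sub_apply, LinearMap.comp_apply, aritW_conv, map_add, map_sub]
      abel
    · simp [aritW_commutator_letterFun]
  exact sub_eq_zero.1 (LinearMap.congr_fun h A)

lemma ariW_jacobi (A B C : Word G → ℚ) :
    ariW (ariW A B) C + ariW (ariW B C) A + ariW (ariW C A) B = 0 := by
  have h (A B C : Word G → ℚ) : ariW (ariW A B) C = aritW C (ariW A B) -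
      (aritW B (aritW A C) - aritW A (aritW B C)) + conv (ariW A B) C - conv C (ariW A B) := by
    rw [aritW_commutator, ariW]
  rw [h, h, h]
  simp only [ariW, map_add, map_sub, aritW_conv, LinearMap.add_apply, LinearMap.sub_apply,
    conv_assoc]
  abel

end WordFunctions

section Bridge

/-- A mould as a function of words. -/
def toWord (M : Mould Γ) : Word Γ → ℚ := fun w =>
  M w.length (fun i => (w.get i).1) (fun i => (w.get i).2)

lemma eq_toWord {G : Type} (M : Mould G) {m : ℕ} {σ : Fin m → G} {x : Fin m → ℚ} (w : Word G)
    (hm : w.length = m) (h : ∀ i : Fin m, w[i.val]? = some (σ i, x i)) :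
    M m σ x = toWord M w := by
  subst hm
  have h' (i : Fin w.length) : w.get i = (σ i, x i) := by
    simpa [List.getElem?_eq_getElem i.2] using h i
  simp only [toWord, h']

lemma toWord_injective {G : Type} : Function.Injective (toWord : Mould G → Word G → ℚ) := by
  intro M N h
  ext m σ x
  have hw (i : Fin m) : (List.ofFn fun i => (σ i, x i))[i.val]? = some (σ i, x i) := by simp
  rw [eq_toWord M _ List.length_ofFn hw, eq_toWord N _ List.length_ofFn hw, h]

lemma toWord_nil {G : Type} {M : Mould G} (hM : IsARI M) : toWord M [] = 0 := hM _ _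

lemma extG_get (w : Word Γ) (i : ℕ) :
    extG (fun i : Fin w.length => (w.get i).1) i = (w.getD i (1, 0)).1 := by
  rw [extG]
  split_ifs with h
  · simp [h]
  · simp [not_lt.1 h]

lemma extQ_get (w : Word Γ) (i : ℕ) :
    extQ (fun i : Fin w.length => (w.get i).2) i = (w.getD i (1, 0)).2 := by
  rw [extQ]
  split_ifs with h
  · simp [h]
  · simp [not_lt.1 h]

lemma weight_take_drop (w : Word Γ) (k n : ℕ) :
    weight ((w.drop k).take n) = ∑ i ∈ Finset.Ico k (k + n), (w.getD i (1, 0)).2 := by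
  induction n with
  | zero => simp
  | succ n ih =>
    rw [← add_assoc, Finset.sum_Ico_succ_top (Nat.le_add_right k n), ← ih, List.take_add_one,
      weight_append, List.getElem?_drop, List.getD_eq_getElem?_getD]
    cases w[k + n]? <;> simp

lemma toWord_mouldMul (A B : Mould Γ) :
    toWord (mouldMul A B) = conv (toWord A) (toWord B) := by
  ext w
  rw [conv_apply, cutSum_eq_sum_range, toWord, mouldMul]
  refine Finset.sum_congr rfl fun k hk => ?_
  rw [Finset.mem_range] at hk
  simp only [extG_get, extQ_get]
  congr 1
  · refine eq_toWord A _ (by simp; omega) fun i => ?_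
    have : i.val < w.length := by omega
    simp [this]
  · refine eq_toWord B _ (by simp) fun i => ?_
    have : k + i.val < w.length := by omega
    simp [this]

lemma toWord_aritU_fst (A B : Mould Γ) (w : Word Γ) {k l : ℕ} (hkl : k ≤ l)
    (hl : l + 1 < w.length) :
    A (w.length - (l - k + 1))
        (fun j => if j.val < k then (w.getD j.val (1, 0)).1
          else if j.val = k then (w.getD (l + 1) (1, 0)).1
          else (w.getD (j.val + (l - k + 1)) (1, 0)).1)
        (fun j => if j.val < k then (w.getD j.val (1, 0)).2
          else if j.val = k then ∑ i ∈ Finset.Icc k (l + 1), (w.getD i (1, 0)).2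
          else (w.getD (j.val + (l - k + 1)) (1, 0)).2) *
      B (l - k + 1)
        (fun j => (w.getD (k + j.val) (1, 0)).1 * ((w.getD (l + 1) (1, 0)).1)⁻¹)
        (fun j => (w.getD (k + j.val) (1, 0)).2) =
    toWord A ((w.take (l + 1)).take k ++ ((w.getD (l + 1) (1, 0)).1,
        weight ((w.take (l + 1)).drop k) + (w.getD (l + 1) (1, 0)).2) :: w.drop (l + 1 + 1)) *
      toWord B (twist (w.getD (l + 1) (1, 0)).1 ((w.take (l + 1)).drop k)) := by
  have hs : weight ((w.take (l + 1)).drop k) + (w.getD (l + 1) (1, 0)).2 =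
      ∑ i ∈ Finset.Icc k (l + 1), (w.getD i (1, 0)).2 := by
    rw [List.drop_take, weight_take_drop, Nat.add_sub_cancel' (by omega),
      ← Finset.Ico_add_one_right_eq_Icc, Finset.sum_Ico_succ_top (b := l + 1) (by omega)]
  rw [hs]
  congr 1
  · refine eq_toWord A _ (by simp; omega) fun i => ?_
    have hi := i.2
    have hk : min k (min (l + 1) w.length) = k := by omega
    rcases lt_trichotomy i.val k with h | h | h
    · have : i.val < w.length := by omega
      have : i.val < l + 1 := by omega
      simp [List.getElem?_append, *]
    · simp [*]
    · obtain ⟨d, hd⟩ := Nat.exists_eq_add_of_lt h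
      have h1 : ¬ i.val < k := by omega
      have h2 : i.val ≠ k := by omega
      have h3 : i.val - k = d + 1 := by omega
      have h4 : l + 1 + 1 + d = i.val + (l - k + 1) := by omega
      have h5 : i.val + (l - k + 1) < w.length := by omega
      rw [List.getElem?_append_right (by simp; omega)]
      simp [*, -hd]
  · refine eq_toWord B _ (by simp [twist]; omega) fun i => ?_
    have : k + i.val < w.length := by omega
    have : k + i.val < l + 1 := by omega
    simp [twist, *]

lemma toWord_aritU_snd (A B : Mould Γ) (w : Word Γ) {k n : ℕ} (hn : k + n + 1 < w.length) :
    A (w.length - (n + 1))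
        (fun j => if j.val < k then (w.getD j.val (1, 0)).1
          else if j.val = k then (w.getD k (1, 0)).1
          else (w.getD (j.val + (n + 1)) (1, 0)).1)
        (fun j => if j.val < k then (w.getD j.val (1, 0)).2
          else if j.val = k then ∑ i ∈ Finset.Icc k (k + n + 1), (w.getD i (1, 0)).2
          else (w.getD (j.val + (n + 1)) (1, 0)).2) *
      B (n + 1)
        (fun j => (w.getD (k + 1 + j.val) (1, 0)).1 * ((w.getD k (1, 0)).1)⁻¹)
        (fun j => (w.getD (k + 1 + j.val) (1, 0)).2) =
    toWord A (w.take k ++ ((w.getD k (1, 0)).1,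
        (w.getD k (1, 0)).2 + weight ((w.drop (k + 1)).take (n + 1))) ::
          (w.drop (k + 1)).drop (n + 1)) *
      toWord B (twist (w.getD k (1, 0)).1 ((w.drop (k + 1)).take (n + 1))) := by
  have hs : (w.getD k (1, 0)).2 + weight ((w.drop (k + 1)).take (n + 1)) =
      ∑ i ∈ Finset.Icc k (k + n + 1), (w.getD i (1, 0)).2 := by
    rw [weight_take_drop, ← Finset.Ico_add_one_right_eq_Icc,
      Finset.sum_eq_sum_Ico_succ_bot (a := k) (by omega)]
    rw [show k + 1 + (n + 1) = k + n + 1 + 1 by omega]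
  rw [hs]
  congr 1
  · refine eq_toWord A _ (by simp; omega) fun i => ?_
    have hi := i.2
    have hk : min k w.length = k := by omega
    rcases lt_trichotomy i.val k with h | h | h
    · have : i.val < w.length := by omega
      simp [List.getElem?_append, *]
    · simp [*]
    · obtain ⟨d, hd⟩ := Nat.exists_eq_add_of_lt h
      have h1 : ¬ i.val < k := by omega
      have h2 : i.val ≠ k := by omega
      have h3 : i.val - k = d + 1 := by omega
      have h4 : k + 1 + (n + 1) + d = i.val + (n + 1) := by omega
      have h5 : i.val + (n + 1) < w.length := by omega
      rw [List.getElem?_append_right (by simp; omega)]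
      simp [*, -hd]
  · refine eq_toWord B _ (by simp [twist]; omega) fun i => ?_
    have : k + 1 + i.val < w.length := by omega
    have : i.val ≤ n := by omega
    simp [twist, *]

lemma toWord_aritU (A B : Mould Γ) (hB : IsARI B) :
    toWord (aritU B A) = aritW (toWord B) (toWord A) := by
  ext w
  rw [aritW, LinearMap.sub_apply, LinearMap.sub_apply, Pi.sub_apply, aritL_apply, aritR_apply,
    markSum_eq_sum_range w (1, 0), markSum_eq_sum_range w (1, 0), toWord, aritU]
  simp only [extG_get, extQ_get]
  congr 1
  · rw [Finset.sum_comm]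
    rcases hw : w.length with _ | m
    · simp
    conv_rhs => rw [Finset.sum_range_succ']
    rw [Finset.sum_range_succ, ← hw]
    simp only [lt_irrefl, and_false, if_false, Finset.sum_const_zero, List.take_zero,
      cutSum, twist_nil, toWord_nil hB, mul_zero, add_zero]
    refine Finset.sum_congr rfl fun l hl => ?_
    have hl' : l + 1 < w.length := by simp at hl; omega
    rw [cutSum_eq_sum_range, Finset.sum_range_succ, List.drop_length, twist_nil, toWord_nil hB,
      mul_zero, add_zero, List.length_take, min_eq_left hl'.le, ← Finset.sum_filter]
    refine Finset.sum_congr ?_ fun k hk => ?_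
    · ext k
      simp
      omega
    · exact toWord_aritU_fst A B w (by simp at hk; omega) hl'
  · rcases hw : w.length with _ | m
    · simp
    conv_rhs => rw [Finset.sum_range_succ]
    rw [Finset.sum_range_succ', ← hw]
    simp only [List.drop_length, cutSum, twist_nil, toWord_nil hB, mul_zero, add_zero,
      nonpos_iff_eq_zero, one_ne_zero, false_and, if_false, Finset.sum_const_zero]
    refine Finset.sum_congr rfl fun k hk => ?_
    have hk' : k + 1 < w.length := by simp at hk; omega
    rw [cutSum_eq_sum_range, Finset.sum_range_succ', List.take_zero, twist_nil, toWord_nil hB,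
      mul_zero, add_zero, ← Finset.sum_filter]
    have hf : (Finset.range w.length).filter (fun l => 1 ≤ k + 1 ∧ k + 1 ≤ l) =
        Finset.Ico (k + 1) w.length := by
      ext l
      simp
      omega
    rw [hf, Finset.sum_Ico_eq_sum_range, List.length_drop]
    refine Finset.sum_congr rfl fun n hn => ?_
    have h1 : k + 1 + n - (k + 1) + 1 = n + 1 := by omega
    have h2 : k + 1 + n = k + n + 1 := by omega
    rw [h1, h2, ← toWord_aritU_snd A B w (by simp at hn; omega)]
    simp only [Nat.add_sub_cancel]

lemma toWord_ariU {A B : Mould Γ} (hA : IsARI A) (hB : IsARI B) :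
    toWord (ariU A B) = ariW (toWord A) (toWord B) := by
  rw [ariW, ← toWord_aritU A B hB, ← toWord_aritU B A hA, ← toWord_mouldMul, ← toWord_mouldMul]
  rfl

lemma IsARI.smul_add {G : Type} {A A' : Mould G} (q : ℚ) (hA : IsARI A) (hA' : IsARI A') :
    IsARI (q • A + A') := fun σ x => by simp [hA σ x, hA' σ x]

lemma IsARI.ariU {A B : Mould Γ} (hA : IsARI A) (hB : IsARI B) : IsARI (ariU A B) :=
  fun σ x => by
    simp [KVMould.ariU, aritU, mouldMul, hA _ _, hB _ _]

end Bridge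

/-- Proposition: `(ARI(Γ), ari_u)` is a Lie algebra over `ℚ`: the bracket of
ARI moulds is an ARI mould, it is `ℚ`-bilinear, alternating, and satisfies
the Jacobi identity. -/
theorem ariU_isLieAlgebra (Γ : Type) [CommGroup Γ] [Fintype Γ] :
    (∀ A B : Mould Γ, IsARI A → IsARI B → IsARI (ariU A B)) ∧
    (∀ (q : ℚ) (A A' B : Mould Γ), IsARI A → IsARI A' → IsARI B →
      ariU (q • A + A') B = q • ariU A B + ariU A' B ∧
      ariU B (q • A + A') = q • ariU B A + ariU B A') ∧
    (∀ A : Mould Γ, IsARI A → ariU A A = 0) ∧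
    (∀ A B C : Mould Γ, IsARI A → IsARI B → IsARI C →
      ariU (ariU A B) C + ariU (ariU B C) A + ariU (ariU C A) B = 0) := by
  refine ⟨fun A B hA hB => hA.ariU hB, fun q A A' B hA hA' hB => ⟨?_, ?_⟩, fun A _ => ?_,
    fun A B C hA hB hC => toWord_injective ?_⟩
  · apply toWord_injective
    change _ = q • toWord (ariU A B) + toWord (ariU A' B)
    rw [toWord_ariU (hA.smul_add q hA') hB, toWord_ariU hA hB, toWord_ariU hA' hB]
    exact ariW_smul_add_left q _ _ _
  · apply toWord_injective
    change _ = q • toWord (ariU B A) + toWord (ariU B A')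
    rw [toWord_ariU hB (hA.smul_add q hA'), toWord_ariU hB hA, toWord_ariU hB hA']
    exact ariW_smul_add_right q _ _ _
  · simp [ariU]
  · change toWord (ariU (ariU A B) C) + toWord (ariU (ariU B C) A) +
      toWord (ariU (ariU C A) B) = 0
    rw [toWord_ariU (hA.ariU hB) hC, toWord_ariU (hB.ariU hC) hA, toWord_ariU (hC.ariU hA) hB,
      toWord_ariU hA hB, toWord_ariU hB hC, toWord_ariU hC hA]
    exact ariW_jacobi _ _ _

end KVMould
end

section
/- Lemma: For every A ∈ ARI(Γ), the linear map arit_u(A) is a derivation of the associative (non-unital) algebra (ARI(Γ), ×): for all B, C ∈ ARI(Γ), arit_u(A)(B×C) = arit_u(A)(B)×C + B×arit_u(A)(C). -/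
namespace KVMould

variable {Γ : Type} [CommGroup Γ]

open Finset in
/-- Reindexing of triples (cut position, block) behind the left half of `aritU`: the cut of the
contracted word lies either after the contracted letter or before it. -/
lemma sum_block_cut_left (F : ℕ → ℕ → ℕ → ℚ) (m : ℕ) :
    (∑ k ∈ range m, ∑ l ∈ range m,
      if k ≤ l ∧ l + 1 < m then ∑ i ∈ range (m - (l - k + 1) + 1), F i k l else 0) =
    (∑ j ∈ range (m + 1), ∑ k ∈ range j, ∑ l ∈ range j,
      if k ≤ l ∧ l + 1 < j then F (j - (l - k + 1)) k l else 0) +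
    ∑ j ∈ range (m + 1), ∑ k ∈ range (m - j), ∑ l ∈ range (m - j),
      if k ≤ l ∧ l + 1 < m - j then F j (j + k) (j + l) else 0 := by
  simp only [← sum_filter, sum_sigma']
  rw [← sum_filter_add_sum_filter_not _ (fun t => t.1 < t.2.2)]
  congr 1
  · refine sum_nbij' (fun t => ⟨t.2.2 + (t.2.1 - t.1 + 1), t.1, t.2.1⟩)
      (fun t => ⟨t.2.1, t.2.2, t.1 - (t.2.2 - t.2.1 + 1)⟩) ?_ ?_ ?_ ?_ ?_ <;>
      rintro ⟨a, b, c⟩ h <;>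
      simp only [mem_filter, mem_sigma, mem_range] at h ⊢ <;> grind
  · refine sum_nbij' (fun t => ⟨t.2.2, t.1 - t.2.2, t.2.1 - t.2.2⟩)
      (fun t => ⟨t.1 + t.2.1, t.1 + t.2.2, t.1⟩) ?_ ?_ ?_ ?_ ?_ <;>
      rintro ⟨a, b, c⟩ h <;>
      simp only [mem_filter, mem_sigma, mem_range] at h ⊢ <;> grind

open Finset in
/-- Reindexing of triples (cut position, block) behind the right half of `aritU`. -/
lemma sum_block_cut_right (F : ℕ → ℕ → ℕ → ℚ) (m : ℕ) :
    (∑ k ∈ range m, ∑ l ∈ range m,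
      if 1 ≤ k ∧ k ≤ l then ∑ i ∈ range (m - (l - k + 1) + 1), F i k l else 0) =
    (∑ j ∈ range (m + 1), ∑ k ∈ range j, ∑ l ∈ range j,
      if 1 ≤ k ∧ k ≤ l then F (j - (l - k + 1)) k l else 0) +
    ∑ j ∈ range (m + 1), ∑ k ∈ range (m - j), ∑ l ∈ range (m - j),
      if 1 ≤ k ∧ k ≤ l then F j (j + k) (j + l) else 0 := by
  simp only [← sum_filter, sum_sigma']
  rw [← sum_filter_add_sum_filter_not _ (fun t => t.1 ≤ t.2.2)]
  congr 1
  · refine sum_nbij' (fun t => ⟨t.2.2 + (t.2.1 - t.1 + 1), t.1, t.2.1⟩)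
      (fun t => ⟨t.2.1, t.2.2, t.1 - (t.2.2 - t.2.1 + 1)⟩) ?_ ?_ ?_ ?_ ?_ <;>
      rintro ⟨a, b, c⟩ h <;>
      simp only [mem_filter, mem_sigma, mem_range] at h ⊢ <;> grind
  · refine sum_nbij' (fun t => ⟨t.2.2, t.1 - t.2.2, t.2.1 - t.2.2⟩)
      (fun t => ⟨t.1 + t.2.1, t.1 + t.2.2, t.1⟩) ?_ ?_ ?_ ?_ ?_ <;>
      rintro ⟨a, b, c⟩ h <;>
      simp only [mem_filter, mem_sigma, mem_range] at h ⊢ <;> grind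

/-- The depth `n` component of a mould, evaluated at infinite words. -/
def evalSeq (M : Mould Γ) (n : ℕ) (s : ℕ → Γ) (y : ℕ → ℚ) : ℚ :=
  M n (fun j => s j.val) (fun j => y j.val)

lemma evalSeq_congr {Δ : Type} (M : Mould Δ) {n n' : ℕ} {s s' : ℕ → Δ} {y y' : ℕ → ℚ}
    (hn : n = n') (hs : ∀ j < n, s j = s' j) (hy : ∀ j < n, y j = y' j) :
    evalSeq M n s y = evalSeq M n' s' y' := by
  subst hn
  unfold evalSeq
  congr 1
  · funext j
    exact hs j j.isLt
  · funext j
    exact hy j j.isLt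

/-- The word `z` with the block of positions `p, …, p + d` replaced by the single letter `v`. -/
def contract {α : Type} (z : ℕ → α) (p d : ℕ) (v : α) : ℕ → α := fun j =>
  if j < p then z j else if j = p then v else z (j + d)

lemma extG_apply {m i : ℕ} (s : ℕ → Γ) (h : i < m) :
    extG (fun j : Fin m => s j.val) i = s i := by
  simp [extG, h]

lemma extQ_apply {m i : ℕ} (y : ℕ → ℚ) (h : i < m) :
    extQ (fun j : Fin m => y j.val) i = y i := by
  simp [extQ, h]

lemma mouldMul_evalSeq (A B : Mould Γ) (m : ℕ) (s : ℕ → Γ) (y : ℕ → ℚ) :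
    evalSeq (mouldMul A B) m s y = ∑ k ∈ Finset.range (m + 1),
      evalSeq A k s y * evalSeq B (m - k) (fun j => s (k + j)) (fun j => y (k + j)) := by
  rw [evalSeq, mouldMul]
  refine Finset.sum_congr rfl fun k hk => ?_
  have hk := Finset.mem_range.mp hk
  refine congrArg₂ (· * ·) (evalSeq_congr A (n' := k) rfl ?_ ?_)
    (evalSeq_congr B (n' := m - k)
      (s := fun i => extG (fun j : Fin m => s j) (k + i))
      (y := fun i => extQ (fun j : Fin m => y j) (k + i)) rfl ?_ ?_) <;> intro j hj
  · exact extG_apply _ (by omega)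
  · exact extQ_apply _ (by omega)
  · exact extG_apply _ (by omega)
  · exact extQ_apply _ (by omega)

/-- The contribution to `arit_u(B)(A)` of the block `k, …, l` absorbed by the letter that
follows it. -/
def leftTerm (B A : Mould Γ) (m : ℕ) (s : ℕ → Γ) (y : ℕ → ℚ) (k l : ℕ) : ℚ :=
  evalSeq A (m - (l - k + 1)) (contract s k (l - k + 1) (s (l + 1)))
      (contract y k (l - k + 1) (∑ i ∈ Finset.Icc k (l + 1), y i)) *
    evalSeq B (l - k + 1) (fun j => s (k + j) * (s (l + 1))⁻¹) (fun j => y (k + j))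

/-- The contribution to `arit_u(B)(A)` of the block `k, …, l` absorbed by the letter that
precedes it. -/
def rightTerm (B A : Mould Γ) (m : ℕ) (s : ℕ → Γ) (y : ℕ → ℚ) (k l : ℕ) : ℚ :=
  evalSeq A (m - (l - k + 1)) (contract s (k - 1) (l - k + 1) (s (k - 1)))
      (contract y (k - 1) (l - k + 1) (∑ i ∈ Finset.Icc (k - 1) l, y i)) *
    evalSeq B (l - k + 1) (fun j => s (k + j) * (s (k - 1))⁻¹) (fun j => y (k + j))

/-- Sum of the terms of `arit_u` with positive sign. -/
def leftSum (B A : Mould Γ) (m : ℕ) (s : ℕ → Γ) (y : ℕ → ℚ) : ℚ :=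
  ∑ k ∈ Finset.range m, ∑ l ∈ Finset.range m,
    if k ≤ l ∧ l + 1 < m then leftTerm B A m s y k l else 0

/-- Sum of the terms of `arit_u` with negative sign. -/
def rightSum (B A : Mould Γ) (m : ℕ) (s : ℕ → Γ) (y : ℕ → ℚ) : ℚ :=
  ∑ k ∈ Finset.range m, ∑ l ∈ Finset.range m,
    if 1 ≤ k ∧ k ≤ l then rightTerm B A m s y k l else 0

lemma sum_Icc_shift (y : ℕ → ℚ) (a b c : ℕ) :
    ∑ i ∈ Finset.Icc a b, y (c + i) = ∑ i ∈ Finset.Icc (c + a) (c + b), y i := by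
  rw [← Finset.map_add_left_Icc, Finset.sum_map]
  rfl

lemma leftTerm_congr (B A : Mould Γ) {m k l : ℕ} {s s' : ℕ → Γ} {y y' : ℕ → ℚ}
    (hs : ∀ j < m, s j = s' j) (hy : ∀ j < m, y j = y' j) (hkl : k ≤ l) (hl : l + 1 < m) :
    leftTerm B A m s y k l = leftTerm B A m s' y' k l := by
  refine congrArg₂ (· * ·) (evalSeq_congr A rfl ?_ ?_) (evalSeq_congr B rfl ?_ ?_) <;>
    intro j hj
  · unfold contract
    grind
  · have : ∑ i ∈ Finset.Icc k (l + 1), y i = ∑ i ∈ Finset.Icc k (l + 1), y' i :=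
      Finset.sum_congr rfl fun i hi => hy i (by have := Finset.mem_Icc.mp hi; omega)
    unfold contract
    grind
  · rw [hs (k + j) (by omega), hs (l + 1) hl]
  · exact hy _ (by omega)

lemma rightTerm_congr (B A : Mould Γ) {m k l : ℕ} {s s' : ℕ → Γ} {y y' : ℕ → ℚ}
    (hs : ∀ j < m, s j = s' j) (hy : ∀ j < m, y j = y' j) (hk : 1 ≤ k) (hkl : k ≤ l)
    (hl : l < m) :
    rightTerm B A m s y k l = rightTerm B A m s' y' k l := by
  refine congrArg₂ (· * ·) (evalSeq_congr A rfl ?_ ?_) (evalSeq_congr B rfl ?_ ?_) <;>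
    intro j hj
  · unfold contract
    grind
  · have : ∑ i ∈ Finset.Icc (k - 1) l, y i = ∑ i ∈ Finset.Icc (k - 1) l, y' i :=
      Finset.sum_congr rfl fun i hi => hy i (by have := Finset.mem_Icc.mp hi; omega)
    unfold contract
    grind
  · rw [hs (k + j) (by omega), hs (k - 1) (by omega)]
  · exact hy _ (by omega)

lemma aritU_evalSeq (B A : Mould Γ) (m : ℕ) (s : ℕ → Γ) (y : ℕ → ℚ) :
    evalSeq (aritU B A) m s y = leftSum B A m s y - rightSum B A m s y := by
  refine congrArg₂ (· - ·)
    (Finset.sum_congr rfl fun k _ => Finset.sum_congr rfl fun l _ => ?_)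
    (Finset.sum_congr rfl fun k _ => Finset.sum_congr rfl fun l hl => ?_)
  · exact if_ctx_congr Iff.rfl (fun h => leftTerm_congr B A (fun j hj => extG_apply s hj)
      (fun j hj => extQ_apply y hj) h.1 h.2) fun _ => rfl
  · exact if_ctx_congr Iff.rfl (fun h => rightTerm_congr B A (fun j hj => extG_apply s hj)
      (fun j hj => extQ_apply y hj) h.1 h.2 (Finset.mem_range.mp hl)) fun _ => rfl

lemma leftSum_mouldMul (A B C : Mould Γ) (m : ℕ) (s : ℕ → Γ) (y : ℕ → ℚ) :
    leftSum A (mouldMul B C) m s y =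
      (∑ j ∈ Finset.range (m + 1),
        leftSum A B j s y * evalSeq C (m - j) (fun i => s (j + i)) (fun i => y (j + i))) +
      ∑ j ∈ Finset.range (m + 1),
        evalSeq B j s y * leftSum A C (m - j) (fun i => s (j + i)) (fun i => y (j + i)) := by
  simp only [leftSum, leftTerm, mouldMul_evalSeq, Finset.sum_mul, Finset.mul_sum, ite_mul,
    mul_ite, zero_mul, mul_zero]
  rw [sum_block_cut_left (m := m)]
  refine congrArg₂ (· + ·) ?_ ?_ <;>
    refine Finset.sum_congr rfl fun j hj => Finset.sum_congr rfl fun k hk =>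
      Finset.sum_congr rfl fun l hl => if_ctx_congr Iff.rfl (fun h => ?_) fun _ => rfl
  · rw [mul_right_comm]
    rw [Finset.mem_range] at *
    refine congrArg₂ (· * ·) (congrArg₂ (· * ·) ?_ rfl) ?_
    · refine evalSeq_congr B rfl ?_ ?_ <;> intro i hi <;> unfold contract <;> grind
    · refine evalSeq_congr C (by omega) ?_ ?_ <;> intro i hi <;> unfold contract <;> grind
  · rw [← mul_assoc]
    rw [Finset.mem_range] at *
    have e : j + l - (j + k) = l - k := by omega
    rw [e]
    refine congrArg₂ (· * ·) (congrArg₂ (· * ·) ?_ ?_) ?_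
    · refine evalSeq_congr B rfl ?_ ?_ <;> intro i hi <;> unfold contract <;> grind
    · refine evalSeq_congr C (by omega) ?_ ?_ <;> intro i hi <;> unfold contract
      · grind
      · rw [sum_Icc_shift]
        grind
    · simp only [add_assoc]

lemma rightSum_mouldMul (A B C : Mould Γ) (m : ℕ) (s : ℕ → Γ) (y : ℕ → ℚ) :
    rightSum A (mouldMul B C) m s y =
      (∑ j ∈ Finset.range (m + 1),
        rightSum A B j s y * evalSeq C (m - j) (fun i => s (j + i)) (fun i => y (j + i))) +
      ∑ j ∈ Finset.range (m + 1),
        evalSeq B j s y * rightSum A C (m - j) (fun i => s (j + i)) (fun i => y (j + i)) := by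
  simp only [rightSum, rightTerm, mouldMul_evalSeq, Finset.sum_mul, Finset.mul_sum, ite_mul,
    mul_ite, zero_mul, mul_zero]
  rw [sum_block_cut_right (m := m)]
  refine congrArg₂ (· + ·) ?_ ?_ <;>
    refine Finset.sum_congr rfl fun j hj => Finset.sum_congr rfl fun k hk =>
      Finset.sum_congr rfl fun l hl => if_ctx_congr Iff.rfl (fun h => ?_) fun _ => rfl
  · rw [mul_right_comm]
    rw [Finset.mem_range] at *
    refine congrArg₂ (· * ·) (congrArg₂ (· * ·) ?_ rfl) ?_
    · refine evalSeq_congr B rfl ?_ ?_ <;> intro i hi <;> unfold contract <;> grind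
    · refine evalSeq_congr C (by omega) ?_ ?_ <;> intro i hi <;> unfold contract <;> grind
  · rw [← mul_assoc]
    rw [Finset.mem_range] at *
    have e : j + l - (j + k) = l - k := by omega
    have e' : j + k - 1 = j + (k - 1) := by omega
    rw [e, e']
    refine congrArg₂ (· * ·) (congrArg₂ (· * ·) ?_ ?_) ?_
    · refine evalSeq_congr B rfl ?_ ?_ <;> intro i hi <;> unfold contract <;> grind
    · refine evalSeq_congr C (by omega) ?_ ?_ <;> intro i hi <;> unfold contract
      · grind
      · rw [sum_Icc_shift]
        grind
    · simp only [add_assoc]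

/-- Lemma: for every `A ∈ ARI(Γ)`, `arit_u(A)` is a derivation of the
associative (non-unital) algebra `(ARI(Γ), ×)`. -/
theorem aritU_isDerivation (Γ : Type) [CommGroup Γ] [Fintype Γ]
    (A B C : Mould Γ) (hA : IsARI A) (hB : IsARI B) (hC : IsARI C) :
    aritU A (mouldMul B C) = mouldMul (aritU A B) C + mouldMul B (aritU A C) := by
  have key (m : ℕ) (s : ℕ → Γ) (y : ℕ → ℚ) :
      evalSeq (aritU A (mouldMul B C)) m s y =
        evalSeq (mouldMul (aritU A B) C) m s y + evalSeq (mouldMul B (aritU A C)) m s y := by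
    simp only [mouldMul_evalSeq, aritU_evalSeq, leftSum_mouldMul, rightSum_mouldMul, sub_mul,
      mul_sub, Finset.sum_sub_distrib]
    ring
  funext m σ x
  simpa [evalSeq, extG, extQ] using key m (extG σ) (extQ x)

end KVMould
end

section
/- Proposition: Define preari_u(A,B) := arit_u(B)(A) + A×B for A, B ∈ ARI(Γ). Then (ARI(Γ), preari_u) is a pre-Lie algebra: for all A, B, C ∈ ARI(Γ), preari_u(A, preari_u(B,C)) − preari_u(preari_u(A,B), C) = preari_u(A, preari_u(C,B)) − preari_u(preari_u(A,C), B). -/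
namespace KVMould

variable {Γ : Type} [CommGroup Γ]

/-- Sum of `H b c` over all factorisations `w = b ++ c`. -/
def splitSum {L : Type} : (List L → List L → ℚ) → List L → ℚ
  | H, [] => H [] []
  | H, x :: w => H [] (x :: w) + splitSum (fun b c => H (x :: b) c) w

/-- The derivation of the convolution algebra of functions on words which replaces a nonempty
factor `b` by the combination of letters dual to `δ b`. -/
def wordDer {L : Type} (δ : List L → (L → ℚ) →ₗ[ℚ] ℚ) : (List L → ℚ) → List L → ℚ
  | _, [] => 0
  | A, x :: w => wordDer δ (fun u => A (x :: u)) w +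
      splitSum (fun b c => δ (x :: b) (fun y => A (y :: c))) w

section Words

variable {L : Type}

theorem splitSum_congr {H K : List L → List L → ℚ} {w : List L}
    (h : ∀ b c, b ++ c = w → H b c = K b c) : splitSum H w = splitSum K w := by
  induction w generalizing H K with
  | nil => exact h [] [] rfl
  | cons x w ih =>
    simp only [splitSum]
    rw [h [] (x :: w) rfl, ih fun b c hbc => h (x :: b) c (by simp [hbc])]

theorem splitSum_add (H K : List L → List L → ℚ) (w : List L) :
    splitSum (fun b c => H b c + K b c) w = splitSum H w + splitSum K w := by
  induction w generalizing H K with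
  | nil => rfl
  | cons x w ih => simp only [splitSum, ih]; ring

theorem splitSum_sub (H K : List L → List L → ℚ) (w : List L) :
    splitSum (fun b c => H b c - K b c) w = splitSum H w - splitSum K w := by
  induction w generalizing H K with
  | nil => rfl
  | cons x w ih => simp only [splitSum, ih]; ring

theorem splitSum_mul_right (H : List L → List L → ℚ) (t : ℚ) (w : List L) :
    splitSum (fun b c => H b c * t) w = splitSum H w * t := by
  induction w generalizing H with
  | nil => rfl
  | cons x w ih => simp only [splitSum, ih]; ring

theorem splitSum_mul_left (H : List L → List L → ℚ) (t : ℚ) (w : List L) :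
    splitSum (fun b c => t * H b c) w = t * splitSum H w := by
  simp only [mul_comm t, splitSum_mul_right]

theorem splitSum_zero (w : List L) : splitSum (fun _ _ => 0) w = 0 := by
  induction w with
  | nil => rfl
  | cons x w ih => simp [splitSum, ih]

theorem splitSum_assoc (K : List L → List L → List L → ℚ) (w : List L) :
    splitSum (fun u c => splitSum (fun a b => K a b c) u) w =
      splitSum (fun a v => splitSum (fun b c => K a b c) v) w := by
  induction w generalizing K with
  | nil => rfl
  | cons x w ih =>
    simp only [splitSum, splitSum_add, ih]
    ring

theorem map_splitSum (φ : (L → ℚ) →ₗ[ℚ] ℚ) (H : L → List L → List L → ℚ) (w : List L) :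
    φ (fun y => splitSum (H y) w) = splitSum (fun b c => φ (fun y => H y b c)) w := by
  induction w generalizing H with
  | nil => rfl
  | cons x w ih =>
    simp only [splitSum]
    rw [← ih, ← map_add]
    rfl

theorem splitSum_map {L' : Type} (s : L → L') (H : List L' → List L' → ℚ) (w : List L) :
    splitSum H (w.map s) = splitSum (fun b c => H (b.map s) (c.map s)) w := by
  induction w generalizing H with
  | nil => rfl
  | cons x w ih => simp [splitSum, ih]

theorem splitSum_eq_left {H : List L → List L → ℚ} (h : ∀ b y c, H b (y :: c) = 0) (w : List L) :
    splitSum H w = H w [] := by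
  induction w generalizing H with
  | nil => rfl
  | cons x w ih => simp [splitSum, h, ih fun b y c => h (x :: b) y c]

theorem wordDer_add (δ : List L → (L → ℚ) →ₗ[ℚ] ℚ) (A B : List L → ℚ) (w : List L) :
    wordDer δ (fun u => A u + B u) w = wordDer δ A w + wordDer δ B w := by
  induction w generalizing A B with
  | nil => simp [wordDer]
  | cons x w ih =>
    simp only [wordDer, ih]
    have h : ∀ b c, δ (x :: b) (fun y => A (y :: c) + B (y :: c)) =
        δ (x :: b) (fun y => A (y :: c)) + δ (x :: b) (fun y => B (y :: c)) :=
      fun b c => map_add (δ (x :: b)) _ _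
    simp only [h, splitSum_add]
    ring

theorem wordDer_mul_left (δ : List L → (L → ℚ) →ₗ[ℚ] ℚ) (t : ℚ) (A : List L → ℚ) (w : List L) :
    wordDer δ (fun u => t * A u) w = t * wordDer δ A w := by
  induction w generalizing A with
  | nil => simp [wordDer]
  | cons x w ih =>
    simp only [wordDer, ih]
    have h : ∀ b c, δ (x :: b) (fun y => t * A (y :: c)) = t * δ (x :: b) (fun y => A (y :: c)) :=
      fun b c => map_smul (δ (x :: b)) t _
    simp only [h, splitSum_mul_left]
    ring

theorem wordDer_sub (δ : List L → (L → ℚ) →ₗ[ℚ] ℚ) (A B : List L → ℚ) (w : List L) :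
    wordDer δ (fun u => A u - B u) w = wordDer δ A w - wordDer δ B w := by
  have h := wordDer_add δ A (fun u => -1 * B u) w
  rw [wordDer_mul_left] at h
  simpa [sub_eq_add_neg] using h

theorem wordDer_sub_left (δ ε : List L → (L → ℚ) →ₗ[ℚ] ℚ) (A : List L → ℚ) (w : List L) :
    wordDer (δ - ε) A w = wordDer δ A w - wordDer ε A w := by
  induction w generalizing A with
  | nil => simp [wordDer]
  | cons x w ih =>
    simp only [wordDer, ih, Pi.sub_apply, LinearMap.sub_apply, splitSum_sub]
    ring

/-- The Leibniz rule for `wordDer`. -/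
theorem wordDer_splitSum (δ : List L → (L → ℚ) →ₗ[ℚ] ℚ) (H : List L → List L → ℚ) (w : List L) :
    wordDer δ (splitSum H) w =
      splitSum (fun b c => wordDer δ (fun u => H u c) b) w +
        splitSum (fun b c => wordDer δ (H b) c) w := by
  induction w generalizing H with
  | nil => simp [wordDer, splitSum]
  | cons x w ih =>
    have h : ∀ b c, δ (x :: b) (fun y => H [] (y :: c) + splitSum (fun a => H (y :: a)) c) =
        δ (x :: b) (fun y => H [] (y :: c)) +
          splitSum (fun d e => δ (x :: b) (fun y => H (y :: d) e)) c := fun b c => by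
      rw [← map_splitSum, ← map_add]; rfl
    simp only [wordDer, splitSum, wordDer_add, ih, h, splitSum_add]
    rw [splitSum_assoc (fun a b c => δ (x :: a) (fun y => H (y :: b) c))]
    ring

theorem wordDer_map (δ : List L → (L → ℚ) →ₗ[ℚ] ℚ) (φ : (L → ℚ) →ₗ[ℚ] ℚ)
    (h : ∀ u (K : L → L → ℚ), δ u (fun z => φ (fun y => K y z)) = φ (fun y => δ u (K y)))
    (K : L → List L → ℚ) (w : List L) :
    wordDer δ (fun u => φ (fun y => K y u)) w = φ (fun y => wordDer δ (K y) w) := by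
  induction w generalizing K with
  | nil => exact (map_zero φ).symm
  | cons x w ih =>
    simp only [wordDer]
    rw [ih fun y u => K y (x :: u)]
    simp only [h _ fun y z => K y (z :: _)]
    rw [← map_splitSum, ← map_add]
    rfl

/-- The letter part of the composite `wordDer δ ∘ wordDer ε`. -/
def letterComp (δ ε : List L → (L → ℚ) →ₗ[ℚ] ℚ) (w : List L) : (L → ℚ) →ₗ[ℚ] ℚ where
  toFun f := wordDer δ (fun u => ε u f) w
  map_add' f g := by simp only [map_add, wordDer_add]
  map_smul' t f := by simp only [map_smul, smul_eq_mul, wordDer_mul_left, RingHom.id_apply]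

/-- Two coderivations commute up to the coderivation given by the commutator of letter parts. -/
theorem wordDer_comm (δ ε : List L → (L → ℚ) →ₗ[ℚ] ℚ)
    (hcomm : ∀ u v (K : L → L → ℚ),
      δ u (fun z => ε v (fun y => K y z)) = ε v (fun y => δ u (K y)))
    (A : List L → ℚ) (w : List L) :
    wordDer δ (wordDer ε A) w - wordDer (letterComp δ ε) A w =
      wordDer ε (wordDer δ A) w - wordDer (letterComp ε δ) A w := by
  induction w generalizing A with
  | nil => rfl
  | cons x w ih =>
    have key : ∀ δ ε : List L → (L → ℚ) →ₗ[ℚ] ℚ,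
        (∀ u v (K : L → L → ℚ),
          δ u (fun z => ε v (fun y => K y z)) = ε v (fun y => δ u (K y))) →
        wordDer δ (wordDer ε A) (x :: w) - wordDer (letterComp δ ε) A (x :: w) =
        (wordDer δ (wordDer ε fun u => A (x :: u)) w -
            wordDer (letterComp δ ε) (fun u => A (x :: u)) w) +
          (splitSum (fun b c => ε (x :: b) (fun y => wordDer δ (fun u => A (y :: u)) c)) w +
            splitSum (fun b c => δ (x :: b) (fun y => wordDer ε (fun u => A (y :: u)) c)) w) := by
      intro δ ε hcomm
      have h1 : ∀ b c, wordDer δ (fun c => ε (x :: b) fun y => A (y :: c)) c =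
          ε (x :: b) (fun y => wordDer δ (fun u => A (y :: u)) c) :=
        fun b c => wordDer_map δ (ε (x :: b)) (fun u => hcomm u (x :: b)) (fun y u => A (y :: u)) c
      have h2 : ∀ b c, δ (x :: b) (fun y => wordDer ε (fun u => A (y :: u)) c +
            splitSum (fun d e => ε (y :: d) (fun z => A (z :: e))) c) =
          δ (x :: b) (fun y => wordDer ε (fun u => A (y :: u)) c) +
            splitSum (fun d e => δ (x :: b) (fun y => ε (y :: d) (fun z => A (z :: e)))) c :=
        fun b c => by rw [← map_splitSum, ← map_add]; rfl
      simp only [wordDer, wordDer_add, wordDer_splitSum, h1, h2, letterComp, splitSum_add,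
        LinearMap.coe_mk, AddHom.coe_mk]
      rw [splitSum_assoc (fun a b c => δ (x :: a) (fun y => ε (y :: b) (fun z => A (z :: c))))]
      ring
    rw [key δ ε hcomm, key ε δ fun u v K => (hcomm v u fun y z => K z y).symm, ih]
    ring

end Words

section SingleLetter

variable {L : Type}

/-- The function supported on one-letter words with values `g`. -/
def onLetter (g : L → ℚ) : List L → ℚ
  | [y] => g y
  | _ => 0

theorem onLetter_add (g h : L → ℚ) (w : List L) :
    onLetter (fun y => g y + h y) w = onLetter g w + onLetter h w := by
  rcases w with _ | ⟨x, _ | ⟨y, w⟩⟩ <;> simp [onLetter]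

theorem onLetter_mul_left (t : ℚ) (g : L → ℚ) (w : List L) :
    onLetter (fun y => t * g y) w = t * onLetter g w := by
  rcases w with _ | ⟨x, _ | ⟨y, w⟩⟩ <;> simp [onLetter]

theorem map_onLetter (φ : (L → ℚ) →ₗ[ℚ] ℚ) (g : L → L → ℚ) (w : List L) :
    φ (fun z => onLetter (g z) w) = onLetter (fun y => φ (fun z => g z y)) w := by
  rcases w with _ | ⟨x, _ | ⟨y, w⟩⟩
  · exact map_zero φ
  · rfl
  · exact map_zero φ

theorem onLetter_splitSum (g : L → List L → List L → ℚ) (c w : List L) :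
    onLetter (fun y => splitSum (g y) w) c =
      splitSum (fun a b => onLetter (fun y => g y a b) c) w := by
  rcases c with _ | ⟨x, _ | ⟨y, c⟩⟩
  · exact (splitSum_zero w).symm
  · rfl
  · exact (splitSum_zero w).symm

theorem wordDer_eq_zero (δ : List L → (L → ℚ) →ₗ[ℚ] ℚ) {A : List L → ℚ}
    (h : ∀ y u, A (y :: u) = 0) (w : List L) : wordDer δ A w = 0 := by
  induction w generalizing A with
  | nil => rfl
  | cons x w ih =>
    have h0 : ∀ b : List L, δ b (fun _ => 0) = 0 := fun b => map_zero (δ b)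
    simp only [wordDer, h, h0, splitSum_zero]
    rw [ih fun _ _ => rfl, add_zero]

theorem wordDer_onLetter {δ : List L → (L → ℚ) →ₗ[ℚ] ℚ} (hδ : δ [] = 0) (g : L → ℚ)
    (w : List L) : wordDer δ (onLetter g) w = δ w g := by
  cases w with
  | nil => simp [hδ, wordDer]
  | cons x w =>
    rw [wordDer, wordDer_eq_zero δ fun _ _ => rfl, splitSum_eq_left, zero_add]
    · rfl
    · exact fun b y c => map_zero (δ (x :: b))

theorem wordDer_onLetter_right (δ : List L → (L → ℚ) →ₗ[ℚ] ℚ) (g : List L → L → ℚ)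
    (b c : List L) :
    wordDer δ (fun u => onLetter (g u) c) b = onLetter (fun y => wordDer δ (fun u => g u y) b) c := by
  rcases c with _ | ⟨x, _ | ⟨y, c⟩⟩
  · exact wordDer_eq_zero δ (fun _ _ => rfl) b
  · rfl
  · exact wordDer_eq_zero δ (fun _ _ => rfl) b

end SingleLetter

section Flexion

/-- The sum of the rational components of a word. -/
def wordSum {G : Type} (w : List (G × ℚ)) : ℚ := (w.map Prod.snd).sum

theorem wordSum_append {G : Type} (b c : List (G × ℚ)) :
    wordSum (b ++ c) = wordSum b + wordSum c := by
  simp [wordSum]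

theorem wordSum_cons {G : Type} (x : G × ℚ) (c : List (G × ℚ)) :
    wordSum (x :: c) = x.2 + wordSum c := by
  simp [wordSum]

variable {G : Type} [CommGroup G]

/-- Translation of the group components of a word by `g⁻¹`. -/
def shiftWord (g : G) (w : List (G × ℚ)) : List (G × ℚ) := w.map fun p => (p.1 * g⁻¹, p.2)

theorem splitSum_shiftWord (g : G) (H : List (G × ℚ) → List (G × ℚ) → ℚ) (w : List (G × ℚ)) :
    splitSum H (shiftWord g w) = splitSum (fun b c => H (shiftWord g b) (shiftWord g c)) w :=
  splitSum_map _ H w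

/-- The part of the letter functional of `arit_u(B)` which contracts a word onto its last
letter. -/
def lastLetter (B : List (G × ℚ) → ℚ) (f : G × ℚ → ℚ) (w : List (G × ℚ)) : ℚ :=
  splitSum (fun b c => onLetter (fun y => B (shiftWord y.1 b) * f (y.1, wordSum b + y.2)) c) w

/-- The part of the letter functional of `arit_u(B)` which contracts a word onto its first
letter. -/
def firstLetter (B : List (G × ℚ) → ℚ) (f : G × ℚ → ℚ) (w : List (G × ℚ)) : ℚ :=
  splitSum (fun b c => onLetter (fun y => B (shiftWord y.1 c) * f (y.1, y.2 + wordSum c)) b) w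

/-- The letter functional of the derivation `arit_u(B)`. -/
def aritLetter (B : List (G × ℚ) → ℚ) (w : List (G × ℚ)) : (G × ℚ → ℚ) →ₗ[ℚ] ℚ where
  toFun f := lastLetter B f w - firstLetter B f w
  map_add' f g := by
    simp only [lastLetter, firstLetter, Pi.add_apply, mul_add, onLetter_add, splitSum_add]
    ring
  map_smul' t f := by
    simp only [lastLetter, firstLetter, Pi.smul_apply, smul_eq_mul, mul_left_comm _ t,
      onLetter_mul_left, splitSum_mul_left, RingHom.id_apply]
    ring

theorem aritLetter_apply (B : List (G × ℚ) → ℚ) (w : List (G × ℚ)) (f : G × ℚ → ℚ) :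
    aritLetter B w f = lastLetter B f w - firstLetter B f w := rfl

theorem aritLetter_nil (B : List (G × ℚ) → ℚ) : aritLetter B [] = 0 := by
  ext f
  simp [aritLetter_apply, lastLetter, firstLetter, splitSum, onLetter]

theorem aritLetter_map (B : List (G × ℚ) → ℚ) (φ : (G × ℚ → ℚ) →ₗ[ℚ] ℚ) (u : List (G × ℚ))
    (K : G × ℚ → G × ℚ → ℚ) :
    aritLetter B u (fun z => φ (fun y => K y z)) = φ (fun y => aritLetter B u (K y)) := by
  have hs : ∀ (t : ℚ) (f : G × ℚ → ℚ), φ (fun y => t * f y) = t * φ f :=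
    fun t f => map_smul φ t f
  have h := map_sub φ (fun y => lastLetter B (K y) u) (fun y => firstLetter B (K y) u)
  simp only [lastLetter, firstLetter, map_splitSum, map_onLetter, hs] at h
  simp only [aritLetter_apply, lastLetter, firstLetter]
  exact h.symm

theorem aritLetter_shiftWord (C : List (G × ℚ) → ℚ) (g : G) (k : G × ℚ → ℚ) (F : ℚ → ℚ)
    (w : List (G × ℚ)) :
    aritLetter C w (fun y => k (y.1 * g⁻¹, y.2) * F y.2) =
      aritLetter C (shiftWord g w) k * F (wordSum w) := by
  simp only [aritLetter_apply, lastLetter, firstLetter, splitSum_shiftWord, sub_mul,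
    ← splitSum_mul_right]
  congr 1 <;> refine splitSum_congr fun b c hbc => ?_
  · subst hbc
    rcases c with _ | ⟨x, _ | ⟨y, c⟩⟩ <;>
      simp [onLetter, shiftWord, wordSum, Function.comp_def, mul_assoc]
  · subst hbc
    rcases b with _ | ⟨x, _ | ⟨y, b⟩⟩ <;>
      simp [onLetter, shiftWord, wordSum, Function.comp_def, mul_assoc]

theorem wordDer_shiftWord (C B : List (G × ℚ) → ℚ) (g : G) (F : ℚ → ℚ) (w : List (G × ℚ)) :
    wordDer (aritLetter C) (fun u => B (shiftWord g u) * F (wordSum u)) w =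
      wordDer (aritLetter C) B (shiftWord g w) * F (wordSum w) := by
  induction w generalizing B F with
  | nil => simp [wordDer, shiftWord]
  | cons x w ih =>
    have hc : shiftWord g (x :: w) = (x.1 * g⁻¹, x.2) :: shiftWord g w := rfl
    rw [hc]
    simp only [wordDer, add_mul]
    congr 1
    · have := ih (fun u => B ((x.1 * g⁻¹, x.2) :: u)) (fun t => F (x.2 + t))
      simpa only [wordSum_cons, shiftWord, List.map_cons] using this
    · rw [splitSum_shiftWord, ← splitSum_mul_right]
      refine splitSum_congr fun b c hbc => ?_
      have := aritLetter_shiftWord C g (fun y => B (y :: shiftWord g c))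
        (fun t => F (t + wordSum c)) (x :: b)
      subst hbc
      simpa only [wordSum_cons, wordSum_append, add_assoc, shiftWord, List.map_cons] using this

/-- The contribution of factorisations `w = b ++ [h] ++ c` in which both outer factors are
contracted onto `h`. -/
def middleLetter (B C : List (G × ℚ) → ℚ) (f : G × ℚ → ℚ) (w : List (G × ℚ)) : ℚ :=
  splitSum (fun b v => splitSum (fun d c => onLetter (fun y =>
    B (shiftWord y.1 b) * C (shiftWord y.1 c) * f (y.1, wordSum b + (y.2 + wordSum c))) d) v) w

theorem wordDer_lastLetter (B C : List (G × ℚ) → ℚ) (f : G × ℚ → ℚ) (w : List (G × ℚ)) :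
    wordDer (aritLetter C) (lastLetter B f) w =
      lastLetter (wordDer (aritLetter C) B) f w +
        lastLetter (splitSum fun b c => B b * C c) f w - middleLetter B C f w := by
  unfold lastLetter
  rw [wordDer_splitSum]
  simp only [wordDer_onLetter (aritLetter_nil C), wordDer_onLetter_right, aritLetter_apply,
    splitSum_sub]
  rw [add_sub_assoc]
  congr 1
  · refine splitSum_congr fun b c _ => ?_
    congr 1
    funext y
    exact wordDer_shiftWord C B y.1 (fun t => f (y.1, t + y.2)) b
  · congr 1
    · simp +unfoldPartialApp only [lastLetter, splitSum_shiftWord, ← splitSum_mul_right,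
        onLetter_splitSum]
      rw [← splitSum_assoc (fun b a c => onLetter (fun y => C (shiftWord y.1 a) *
        (B (shiftWord y.1 b) * f (y.1, wordSum b + (wordSum a + y.2)))) c)]
      refine splitSum_congr fun u c _ => splitSum_congr fun b a hu => ?_
      subst hu
      congr 1
      funext y
      rw [wordSum_append, add_assoc]
      ring
    · refine splitSum_congr fun b v _ => splitSum_congr fun d c _ => ?_
      congr 1
      funext y
      ring

theorem wordDer_firstLetter (B C : List (G × ℚ) → ℚ) (f : G × ℚ → ℚ) (w : List (G × ℚ)) :
    wordDer (aritLetter C) (firstLetter B f) w =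
      firstLetter (wordDer (aritLetter C) B) f w -
        firstLetter (splitSum fun b c => C b * B c) f w + middleLetter C B f w := by
  unfold firstLetter
  rw [wordDer_splitSum]
  simp only [wordDer_onLetter (aritLetter_nil C), wordDer_onLetter_right, aritLetter_apply,
    splitSum_sub]
  have hB : splitSum (fun b c => onLetter (fun y => wordDer (aritLetter C)
        (fun u => B (shiftWord y.1 u) * f (y.1, y.2 + wordSum u)) c) b) w =
      splitSum (fun b c => onLetter (fun y => wordDer (aritLetter C) B (shiftWord y.1 c) *
        f (y.1, y.2 + wordSum c)) b) w := by
    refine splitSum_congr fun b c _ => ?_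
    congr 1
    funext y
    exact wordDer_shiftWord C B y.1 (fun t => f (y.1, y.2 + t)) c
  have hlast : splitSum (fun b c => lastLetter C
        (fun y => B (shiftWord y.1 c) * f (y.1, y.2 + wordSum c)) b) w =
      middleLetter C B f w := by
    unfold lastLetter middleLetter
    rw [splitSum_assoc (fun a b c => onLetter (fun y => C (shiftWord y.1 a) *
      (B (shiftWord y.1 c) * f (y.1, wordSum a + y.2 + wordSum c))) b)]
    simp only [mul_assoc, add_assoc]
  have hfirst : splitSum (fun b c => firstLetter C
        (fun y => B (shiftWord y.1 c) * f (y.1, y.2 + wordSum c)) b) w =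
      splitSum (fun b c => onLetter (fun y => splitSum (fun b c => C b * B c) (shiftWord y.1 c) *
        f (y.1, y.2 + wordSum c)) b) w := by
    simp +unfoldPartialApp only [firstLetter, splitSum_shiftWord, ← splitSum_mul_right,
      onLetter_splitSum]
    rw [splitSum_assoc (fun b a c => onLetter (fun y => C (shiftWord y.1 a) *
      (B (shiftWord y.1 c) * f (y.1, y.2 + wordSum a + wordSum c))) b)]
    refine splitSum_congr fun b v _ => splitSum_congr fun a c hv => ?_
    subst hv
    simp only [wordSum_append, mul_assoc, add_assoc]
  rw [hB, hlast, hfirst]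
  ring

theorem lastLetter_add (B C : List (G × ℚ) → ℚ) (f : G × ℚ → ℚ) (w : List (G × ℚ)) :
    lastLetter (fun u => B u + C u) f w = lastLetter B f w + lastLetter C f w := by
  simp only [lastLetter, add_mul, onLetter_add, splitSum_add]

theorem firstLetter_add (B C : List (G × ℚ) → ℚ) (f : G × ℚ → ℚ) (w : List (G × ℚ)) :
    firstLetter (fun u => B u + C u) f w = firstLetter B f w + firstLetter C f w := by
  simp only [firstLetter, add_mul, onLetter_add, splitSum_add]

/-- The operation `preari_u` on functions on words. -/
def wordPreari (A B : List (G × ℚ) → ℚ) (w : List (G × ℚ)) : ℚ :=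
  wordDer (aritLetter B) A w + splitSum (fun b c => A b * B c) w

theorem letterComp_aritLetter (B C : List (G × ℚ) → ℚ) :
    aritLetter (wordPreari B C) - letterComp (aritLetter C) (aritLetter B) =
      aritLetter (wordPreari C B) - letterComp (aritLetter B) (aritLetter C) := by
  have h : ∀ (B C : List (G × ℚ) → ℚ) (w : List (G × ℚ)) (f : G × ℚ → ℚ),
      aritLetter (wordPreari B C) w f - letterComp (aritLetter C) (aritLetter B) w f =
        middleLetter B C f w + middleLetter C B f w -
          (firstLetter (splitSum fun b c => B b * C c) f w +
            firstLetter (splitSum fun b c => C b * B c) f w) := by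
    intro B C w f
    have hcomp : letterComp (aritLetter C) (aritLetter B) w f =
        wordDer (aritLetter C) (lastLetter B f) w - wordDer (aritLetter C) (firstLetter B f) w :=
      wordDer_sub (aritLetter C) (lastLetter B f) (firstLetter B f) w
    rw [hcomp, wordDer_lastLetter, wordDer_firstLetter, aritLetter_apply]
    unfold wordPreari
    rw [lastLetter_add, firstLetter_add]
    ring
  funext w
  ext f
  simp only [Pi.sub_apply, LinearMap.sub_apply, h]
  ring

/-- `wordPreari` satisfies the (right) pre-Lie identity. -/
theorem wordPreari_preLie (A B C : List (G × ℚ) → ℚ) (w : List (G × ℚ)) :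
    wordPreari A (wordPreari B C) w - wordPreari (wordPreari A B) C w =
      wordPreari A (wordPreari C B) w - wordPreari (wordPreari A C) B w := by
  have hder := wordDer_comm (aritLetter C) (aritLetter B)
    (fun u v K => aritLetter_map C (aritLetter B v) u K) A w
  have hletter : wordDer (aritLetter (wordPreari B C)) A w -
        wordDer (letterComp (aritLetter C) (aritLetter B)) A w =
      wordDer (aritLetter (wordPreari C B)) A w -
        wordDer (letterComp (aritLetter B) (aritLetter C)) A w := by
    rw [← wordDer_sub_left, ← wordDer_sub_left, letterComp_aritLetter]
  have h : ∀ B C : List (G × ℚ) → ℚ,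
      wordPreari A (wordPreari B C) w - wordPreari (wordPreari A B) C w =
        wordDer (aritLetter (wordPreari B C)) A w -
          wordDer (aritLetter C) (wordDer (aritLetter B) A) w -
          splitSum (fun b c => wordDer (aritLetter C) A b * B c) w -
          splitSum (fun b c => wordDer (aritLetter B) A b * C c) w := by
    intro B C
    have hmul : ∀ (t : ℚ) (D : List (G × ℚ) → ℚ) u,
        wordDer (aritLetter C) (fun v => D v * t) u = wordDer (aritLetter C) D u * t := by
      intro t D u
      simp only [mul_comm _ t, wordDer_mul_left]
    have hleib := wordDer_splitSum (aritLetter C) (fun b c => A b * B c) w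
    simp only [hmul, wordDer_mul_left] at hleib
    have hassoc := splitSum_assoc (fun a b c => A a * B b * C c) w
    simp only [splitSum_mul_right] at hassoc
    simp only [mul_assoc, splitSum_mul_left] at hassoc
    unfold wordPreari
    simp only [mul_add, add_mul, splitSum_add, wordDer_add]
    rw [hleib, hassoc]
    ring
  rw [h B C, h C B]
  linarith

end Flexion

section Translation

theorem splitSum_eq_sum_range {L : Type} (H : List L → List L → ℚ) (w : List L) :
    splitSum H w = ∑ k ∈ Finset.range (w.length + 1), H (w.take k) (w.drop k) := by
  induction w generalizing H with
  | nil => simp [splitSum]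
  | cons x w ih =>
    rw [splitSum, ih, List.length_cons, Finset.sum_range_succ' _ (w.length + 1), add_comm]
    simp

theorem wordDer_eq_sum_range {L : Type} {δ : List L → (L → ℚ) →ₗ[ℚ] ℚ} (A : List L → ℚ)
    (w : List L) :
    wordDer δ A w = ∑ k ∈ Finset.range w.length, ∑ j ∈ Finset.range (w.length - k),
      δ ((w.drop k).take (j + 1)) (fun y => A (w.take k ++ y :: w.drop (k + j + 1))) := by
  induction w generalizing A with
  | nil => simp [wordDer]
  | cons x w ih =>
    rw [wordDer, ih, splitSum_eq_sum_range, List.length_cons,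
      Finset.sum_range_succ' (fun k => ∑ j ∈ Finset.range (w.length + 1 - k), _)]
    simp [add_right_comm _ 1]

theorem splitSum_onLetter_concat {L : Type} (g : List L → L → ℚ) (u : List L) (y : L) :
    splitSum (fun b c => onLetter (g b) c) (u ++ [y]) = g u y := by
  induction u generalizing g with
  | nil => simp [splitSum, onLetter]
  | cons x u ih =>
    rw [List.cons_append, splitSum, ih fun b => g (x :: b)]
    cases u <;> simp [onLetter]

theorem splitSum_onLetter_cons {L : Type} (g : List L → L → ℚ) (x : L) (u : List L) :
    splitSum (fun b c => onLetter (g c) b) (x :: u) = g u x := by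
  cases u with
  | nil => simp [splitSum, onLetter]
  | cons y u => simp [splitSum, onLetter, splitSum_zero]

theorem sum_range_block_right (m : ℕ) (F : ℕ → ℕ → ℚ) :
    (∑ k ∈ Finset.range m, ∑ l ∈ Finset.range m,
      if k ≤ l ∧ l + 1 < m then F k (l - k + 1) else 0) =
    ∑ k ∈ Finset.range m, ∑ j ∈ Finset.range (m - k), if 1 ≤ j then F k j else 0 := by
  refine Finset.sum_congr rfl fun k _ => ?_
  rw [← Finset.sum_filter, ← Finset.sum_filter]
  refine Finset.sum_nbij' (fun l => l - k + 1) (fun j => k + j - 1) ?_ ?_ ?_ ?_ ?_ <;>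
    simp only [Finset.mem_filter, Finset.mem_range] <;> intros
  all_goals first | rfl | trivial | omega

theorem sum_range_block_left (m : ℕ) (F : ℕ → ℕ → ℚ) :
    (∑ k ∈ Finset.range m, ∑ l ∈ Finset.range m,
      if 1 ≤ k ∧ k ≤ l then F (k - 1) (l - k + 1) else 0) =
    ∑ k ∈ Finset.range m, ∑ j ∈ Finset.range (m - k), if 1 ≤ j then F k j else 0 := by
  cases m with
  | zero => rfl
  | succ n =>
    rw [Finset.sum_range_succ',
      Finset.sum_range_succ (fun k => ∑ j ∈ Finset.range (n + 1 - k), if 1 ≤ j then F k j else 0)]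
    congr 1
    · refine Finset.sum_congr rfl fun k _ => ?_
      rw [← Finset.sum_filter, ← Finset.sum_filter]
      refine Finset.sum_nbij' (fun l => l - (k + 1) + 1) (fun j => k + j) ?_ ?_ ?_ ?_ ?_ <;>
        simp only [Finset.mem_filter, Finset.mem_range] <;> intros
      all_goals first | rfl | trivial | omega
    · simp

theorem wordSum_take_drop {G : Type} (w : List (G × ℚ)) (k n : ℕ) (h : k + n ≤ w.length) :
    wordSum ((w.drop k).take n) =
      ∑ i ∈ Finset.Ico k (k + n), extQ (fun i : Fin w.length => w[i.val].2) i := by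
  induction n with
  | zero => simp [wordSum]
  | succ n ih =>
    have hn : n < (w.drop k).length := by simp; omega
    rw [← List.take_append_getElem hn, wordSum_append, ih (by omega), ← add_assoc,
      Finset.sum_Ico_succ_top (by omega), extQ, dif_pos (by omega)]
    simp [wordSum]

variable {G : Type} [CommGroup G]

theorem lastLetter_concat (B : List (G × ℚ) → ℚ) (f : G × ℚ → ℚ) (u : List (G × ℚ)) (y : G × ℚ) :
    lastLetter B f (u ++ [y]) = B (shiftWord y.1 u) * f (y.1, wordSum u + y.2) :=
  splitSum_onLetter_concat (fun b y => B (shiftWord y.1 b) * f (y.1, wordSum b + y.2)) u y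

theorem firstLetter_cons (B : List (G × ℚ) → ℚ) (f : G × ℚ → ℚ) (x : G × ℚ) (u : List (G × ℚ)) :
    firstLetter B f (x :: u) = B (shiftWord x.1 u) * f (x.1, x.2 + wordSum u) :=
  splitSum_onLetter_cons (fun c y => B (shiftWord y.1 c) * f (y.1, y.2 + wordSum c)) x u

/-- A mould viewed as a function on words. -/
def wordEval {G : Type} (M : Mould G) (w : List (G × ℚ)) : ℚ :=
  M w.length (fun i => w[i.val].1) (fun i => w[i.val].2)

theorem wordEval_eq {G : Type} (M : Mould G) {v : List (G × ℚ)} {n : ℕ} (hn : v.length = n)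
    {σ : Fin n → G} {x : Fin n → ℚ}
    (h : ∀ (i : ℕ) (hi : i < v.length), v[i] = (σ ⟨i, hn ▸ hi⟩, x ⟨i, hn ▸ hi⟩)) :
    M n σ x = wordEval M v := by
  subst hn
  unfold wordEval
  congr 1 <;> funext i <;> simp [h i i.2]

theorem wordEval_injective {G : Type} : Function.Injective (wordEval (G := G)) := by
  intro M N h
  funext m σ x
  have := congrFun h (List.ofFn fun i => (σ i, x i))
  rwa [← wordEval_eq M (List.length_ofFn) (σ := σ) (x := x) (by simp),
    ← wordEval_eq N (List.length_ofFn) (σ := σ) (x := x) (by simp)] at this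

theorem extG_getElem (w : List (G × ℚ)) {i : ℕ} (h : i < w.length) :
    extG (fun i : Fin w.length => w[i.val].1) i = w[i].1 := dif_pos h

theorem extQ_getElem {G : Type} (w : List (G × ℚ)) {i : ℕ} (h : i < w.length) :
    extQ (fun i : Fin w.length => w[i.val].2) i = w[i].2 := dif_pos h

theorem wordEval_mouldMul (A B : Mould G) (w : List (G × ℚ)) :
    wordEval (mouldMul A B) w = splitSum (fun b c => wordEval A b * wordEval B c) w := by
  rw [splitSum_eq_sum_range]
  unfold wordEval mouldMul
  refine Finset.sum_congr rfl fun k hk => ?_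
  have hk' : k ≤ w.length := by simpa [Nat.lt_succ_iff] using hk
  congr 1
  · refine wordEval_eq A (by simpa) fun i hi => ?_
    have hi' : i < w.length := by simp at hi; omega
    simp [extG_getElem w hi', extQ_getElem w hi']
  · refine wordEval_eq B (by simp) fun i hi => ?_
    have hi' : k + i < w.length := by simp at hi; omega
    simp [extG_getElem w hi', extQ_getElem w hi']

/-- Evaluation of a mould on the word obtained from `w` by replacing the `n + 1` letters starting
at position `k` with one letter. -/
theorem wordEval_contract (A : Mould G) (w : List (G × ℚ)) {k n : ℕ} (h : k + n < w.length)
    (g : G) (t : ℚ) :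
    A (w.length - n)
      (fun j => if j.val < k then extG (fun i : Fin w.length => w[i.val].1) j.val
        else if j.val = k then g else extG (fun i : Fin w.length => w[i.val].1) (j.val + n))
      (fun j => if j.val < k then extQ (fun i : Fin w.length => w[i.val].2) j.val
        else if j.val = k then t else extQ (fun i : Fin w.length => w[i.val].2) (j.val + n)) =
    wordEval A (w.take k ++ (g, t) :: w.drop (k + n + 1)) := by
  refine wordEval_eq A (by simp; omega) fun i hi => ?_
  have hi' : i + n < w.length := by simp at hi; omega
  rcases lt_trichotomy i k with hik | rfl | hik
  · have hiw : i < w.length := by omega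
    simp [hik, extG_getElem w hiw, extQ_getElem w hiw, hiw]
  · have hi0 : min i w.length = i := by omega
    simp [hi0]
  · obtain ⟨d, rfl⟩ := Nat.exists_eq_add_of_lt hik
    have hk : min k w.length = k := by omega
    have he : k + d + 1 - k = d + 1 := by omega
    have he' : k + n + 1 + d = k + d + 1 + n := by omega
    simp [List.getElem_append, hk, he, he', extG_getElem w hi', extQ_getElem w hi',
      show ¬ k + d + 1 < k by omega, show ¬ k + d + 1 = k by omega]

theorem wordEval_block (B : Mould G) (w : List (G × ℚ)) {k n : ℕ} (h : k + n ≤ w.length) (g : G) :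
    B n (fun j => extG (fun i : Fin w.length => w[i.val].1) (k + j.val) * g⁻¹)
      (fun j => extQ (fun i : Fin w.length => w[i.val].2) (k + j.val)) =
    wordEval B (shiftWord g ((w.drop k).take n)) := by
  refine wordEval_eq B (by simp [shiftWord]; omega) fun i hi => ?_
  have hi' : k + i < w.length := by simp [shiftWord] at hi; omega
  simp [shiftWord, extG_getElem w hi', extQ_getElem w hi']

theorem wordEval_aritU (B A : Mould G) (w : List (G × ℚ)) :
    wordEval (aritU B A) w = wordDer (aritLetter (wordEval B)) (wordEval A) w := by
  set F : ℕ → ℕ → G × ℚ → ℚ :=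
    fun k j y => wordEval A (w.take k ++ y :: w.drop (k + j + 1)) with hF
  set P : ℕ → ℕ → ℚ :=
    fun k j => lastLetter (wordEval B) (F k j) ((w.drop k).take (j + 1)) with hP
  set Q : ℕ → ℕ → ℚ :=
    fun k j => firstLetter (wordEval B) (F k j) ((w.drop k).take (j + 1)) with hQ
  have hsum : wordDer (aritLetter (wordEval B)) (wordEval A) w =
      (∑ k ∈ Finset.range w.length, ∑ j ∈ Finset.range (w.length - k),
        if 1 ≤ j then P k j else 0) -
      ∑ k ∈ Finset.range w.length, ∑ j ∈ Finset.range (w.length - k),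
        if 1 ≤ j then Q k j else 0 := by
    rw [wordDer_eq_sum_range, ← Finset.sum_sub_distrib]
    refine Finset.sum_congr rfl fun k hk => ?_
    rw [← Finset.sum_sub_distrib]
    refine Finset.sum_congr rfl fun j hj => ?_
    rw [aritLetter_apply]
    rcases Nat.eq_zero_or_pos j with rfl | hj
    · have hk' : k < w.length := Finset.mem_range.mp hk
      rw [List.drop_eq_getElem_cons hk', List.take_succ_cons, List.take_zero, firstLetter_cons,
        ← List.nil_append [w[k]], lastLetter_concat]
      simp [wordSum]
    · simp [Nat.succ_le_of_lt hj, hP, hQ, hF]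
  rw [hsum, ← sum_range_block_right, ← sum_range_block_left]
  unfold wordEval aritU
  congr 1
  · refine Finset.sum_congr rfl fun k _ => Finset.sum_congr rfl fun l _ => ?_
    split_ifs with hkl
    · have hj : l - k + 1 < (w.drop k).length := by simp; omega
      have hl : k + (l - k + 1) = l + 1 := by omega
      have hsum : ∑ i ∈ Finset.Icc k (l + 1), extQ (fun i : Fin w.length => w[i.val].2) i =
          wordSum ((w.drop k).take (l - k + 1 + 1)) := by
        rw [wordSum_take_drop w k _ (by omega), ← hl]
        rfl
      simp only [hP]
      rw [hsum, wordEval_contract A w (by omega), extG_getElem w hkl.2,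
        wordEval_block B w (by omega), ← List.take_append_getElem hj, lastLetter_concat, hF,
        mul_comm, wordSum_append]
      simp [wordSum, hl]
    · rfl
  · refine Finset.sum_congr rfl fun k _ => Finset.sum_congr rfl fun l hl => ?_
    split_ifs with hkl
    · have hl : l < w.length := Finset.mem_range.mp hl
      have hk : k - 1 < w.length := by omega
      have hk' : k - 1 + 1 = k := by omega
      have hl' : k - 1 + (l - k + 1) = l := by omega
      have hsum : ∑ i ∈ Finset.Icc (k - 1) l, extQ (fun i : Fin w.length => w[i.val].2) i =
          wordSum ((w.drop (k - 1)).take (l - k + 1 + 1)) := by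
        rw [wordSum_take_drop w (k - 1) _ (by omega), ← add_assoc, hl']
        rfl
      simp only [hQ]
      rw [hsum, wordEval_contract A w (by omega), extG_getElem w hk,
        wordEval_block B w (by omega), List.drop_eq_getElem_cons hk, List.take_succ_cons,
        firstLetter_cons, hF, hk', mul_comm, wordSum_cons]
    · rfl

theorem wordEval_preariU (A B : Mould G) :
    wordEval (preariU A B) = wordPreari (wordEval A) (wordEval B) := by
  funext w
  exact congrArg₂ (· + ·) (wordEval_aritU B A w) (wordEval_mouldMul A B w)

end Translation

/-- Proposition: `(ARI(Γ), preari_u)` is a pre-Lie algebra. -/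
theorem preariU_preLie (Γ : Type) [CommGroup Γ] [Fintype Γ]
    (A B C : Mould Γ) (hA : IsARI A) (hB : IsARI B) (hC : IsARI C) :
    preariU A (preariU B C) - preariU (preariU A B) C =
      preariU A (preariU C B) - preariU (preariU A C) B := by
  refine wordEval_injective (funext fun w => ?_)
  have h := wordPreari_preLie (wordEval A) (wordEval B) (wordEval C) w
  simp only [← wordEval_preariU] at h
  exact h

end KVMould
end
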